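/- If a Bruhat interval [u,w] in a Weyl group W is a zircon, then deg_{u,w}(w) = ℓ(w) − ℓ(u). -/

import Mathlib

namespace Paper

/-! ### Bruhat order on a Coxeter group -/

variable {B W : Type*} [Group W] {M : CoxeterMatrix B}

/-- One step in the Bruhat order: multiply on the left by a reflection,
increasing the length. -/
def BruhatStep (cs : CoxeterSystem M W) (a b : W) : Prop :=
  ∃ t : W, cs.IsReflection t ∧ b = t * a ∧ cs.length a < cs.length b

/-- The Bruhat order on a Coxeter group. -/
def BruhatLE (cs : CoxeterSystem M W) : W → W → Prop :=
  Relation.ReflTransGen (BruhatStep cs)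

theorem BruhatLE.length_le {cs : CoxeterSystem M W} {a b : W} (h : BruhatLE cs a b) :
    cs.length a ≤ cs.length b := by
  induction h with
  | refl => exact le_rfl
  | tail _ h ih => obtain ⟨t, -, -, hlt⟩ := h; exact ih.trans hlt.le

theorem BruhatLE.length_lt {cs : CoxeterSystem M W} {a b : W} (h : BruhatLE cs a b)
    (hne : a ≠ b) : cs.length a < cs.length b := by
  rcases Relation.ReflTransGen.cases_head h with h' | ⟨c, hc, h'⟩
  · exact absurd h' hne
  · obtain ⟨t, -, -, hlt⟩ := hc
    exact lt_of_lt_of_le hlt (BruhatLE.length_le h')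

theorem BruhatLE.antisymm {cs : CoxeterSystem M W} {a b : W} (h1 : BruhatLE cs a b)
    (h2 : BruhatLE cs b a) : a = b := by
  by_contra hne
  exact absurd (BruhatLE.length_lt h1 hne) (not_lt.mpr (BruhatLE.length_le h2))

/-- The Bruhat interval `[u,w]`, as a type. -/
abbrev BruhatInterval (cs : CoxeterSystem M W) (u w : W) : Type _ :=
  {y : W // BruhatLE cs u y ∧ BruhatLE cs y w}

/-- The Bruhat interval `[u,w]` is a poset under the Bruhat order. -/
instance (cs : CoxeterSystem M W) (u w : W) : PartialOrder (BruhatInterval cs u w) where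
  le a b := BruhatLE cs a.1 b.1
  le_refl _ := Relation.ReflTransGen.refl
  le_trans _ _ _ := Relation.ReflTransGen.trans
  le_antisymm _ _ h1 h2 := Subtype.ext (BruhatLE.antisymm h1 h2)

/-- A principal order ideal `{v : v ≤ x}` of the Bruhat order, as a type. -/
abbrev BruhatIdeal (cs : CoxeterSystem M W) (x : W) : Type _ :=
  {v : W // BruhatLE cs v x}

/-- A principal order ideal of the Bruhat order is a poset under the Bruhat order. -/
instance (cs : CoxeterSystem M W) (x : W) : PartialOrder (BruhatIdeal cs x) where
  le a b := BruhatLE cs a.1 b.1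
  le_refl _ := Relation.ReflTransGen.refl
  le_trans _ _ _ := Relation.ReflTransGen.trans
  le_antisymm _ _ h1 h2 := Subtype.ext (BruhatLE.antisymm h1 h2)

/-! ### Posets: matchings, special matchings and zircons -/

/-- A matching of a poset: an involution matching each element with an element
covering it or covered by it. -/
def IsMatching {α : Type*} [PartialOrder α] (f : α → α) : Prop :=
  Function.Involutive f ∧ ∀ x : α, f x ⋖ x ∨ x ⋖ f x

/-- A special matching of a poset. -/
def IsSpecialMatching {α : Type*} [PartialOrder α] (f : α → α) : Prop :=
  IsMatching f ∧ ∀ x y : α, x ⋖ y → f x = y ∨ f x < f y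

/-- A zircon: a poset in which the principal order ideal of every non-minimal element is
finite and has a special matching. -/
def IsZircon (α : Type*) [PartialOrder α] : Prop :=
  ∀ x : α, (∃ y : α, y < x) →
    ({v : α | v ≤ x}.Finite ∧
      ∃ f : {v : α // v ≤ x} → {v : α // v ≤ x}, IsSpecialMatching f)

/-- The degree of `v` in the Bruhat graph of the interval `[u,w]`: the number of `y ∈ [u,w]`
such that `v⁻¹ * y` is a reflection. -/
noncomputable def bruhatDeg (cs : CoxeterSystem M W) (u w v : W) : ℕ :=
  Nat.card {y : W // (BruhatLE cs u y ∧ BruhatLE cs y w) ∧ cs.IsReflection (v⁻¹ * y)}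

/-- A Bruhat interval `[u,w]` is rationally smooth if `deg_{y,w}(y) = ℓ(w) - ℓ(y)` for all
`y ∈ [u,w]` (Carrell–Peterson). -/
def RationallySmooth (cs : CoxeterSystem M W) (u w : W) : Prop :=
  ∀ y : W, BruhatLE cs u y → BruhatLE cs y w →
    bruhatDeg cs y w y = cs.length w - cs.length y

/-! ### Root data -/

/-- A linear representation of a Coxeter group in which each reflection `t` acts as the reflection
in a positive root `root t`, and the sign of the image of a root is controlled by the length. -/
structure RootData (cs : CoxeterSystem M W) (V : Type*) [AddCommGroup V] [Module ℝ V] where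
  act : W →* Module.End ℝ V
  root : W → V
  form : V →ₗ[ℝ] V →ₗ[ℝ] ℝ
  height : V →ₗ[ℝ] ℝ
  form_symm : ∀ v v', form v v' = form v' v
  form_root_self : ∀ {t}, cs.IsReflection t → form (root t) (root t) = 2
  act_reflection : ∀ {t}, cs.IsReflection t → ∀ v, act t v = v - form (root t) v • root t
  height_pos : ∀ {t}, cs.IsReflection t → 0 < height (root t)
  eq_of_root_eq_smul : ∀ {t r}, cs.IsReflection t → cs.IsReflection r →
    ∀ {c : ℝ}, root t = c • root r → t = r
  act_root_of_lt : ∀ {t g}, cs.IsReflection t → cs.length g < cs.length (g * t) →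
    act g (root t) = root (g * t * g⁻¹)
  act_root_of_gt : ∀ {t g}, cs.IsReflection t → cs.length (g * t) < cs.length g →
    act g (root t) = -root (g * t * g⁻¹)

namespace RootData

variable {cs : CoxeterSystem M W} {V : Type*} [AddCommGroup V] [Module ℝ V] (D : RootData cs V)
include D

theorem act_act (g h : W) (v : V) : D.act g (D.act h v) = D.act (g * h) v := by
  rw [map_mul]; rfl

theorem act_root_eq_or {t : W} (ht : cs.IsReflection t) (g : W) :
    D.act g (D.root t) = D.root (g * t * g⁻¹) ∨ D.act g (D.root t) = -D.root (g * t * g⁻¹) := by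
  rcases lt_or_gt_of_ne (ht.length_mul_left_ne g) with h | h
  · exact .inr (D.act_root_of_gt ht h)
  · exact .inl (D.act_root_of_lt ht h)

theorem lt_iff_height_pos {r : W} (hr : cs.IsReflection r) (x : W) :
    cs.length x < cs.length (r * x) ↔ 0 < D.height (D.act x⁻¹ (D.root r)) := by
  have e : cs.length (x⁻¹ * r) = cs.length (r * x) := by
    rw [← cs.length_inv (r * x), mul_inv_rev, hr.inv]
  have hp := D.height_pos (hr.conj x⁻¹)
  constructor
  · intro h
    rw [D.act_root_of_lt hr (by rwa [cs.length_inv, e])]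
    exact hp
  · intro h
    by_contra h'
    have h2 := lt_of_le_of_ne (not_lt.mp h') (hr.length_mul_right_ne x)
    rw [D.act_root_of_gt hr (by rwa [cs.length_inv, e]), map_neg] at h
    linarith

theorem gt_iff_height_neg {r : W} (hr : cs.IsReflection r) (x : W) :
    cs.length (r * x) < cs.length x ↔ D.height (D.act x⁻¹ (D.root r)) < 0 := by
  have h0 : D.height (D.act x⁻¹ (D.root r)) ≠ 0 := by
    have hp := D.height_pos (hr.conj x⁻¹)
    rcases D.act_root_eq_or hr x⁻¹ with h | h <;> rw [h]
    · exact hp.ne'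
    · rw [map_neg]; exact (neg_neg_of_pos hp).ne
  have := D.lt_iff_height_pos hr x
  have hn := hr.length_mul_right_ne x
  rcases lt_or_gt_of_ne h0 with h | h
  · exact ⟨fun _ => h, fun _ => lt_of_le_of_ne (not_lt.mp fun h' => (this.mp h').not_gt h) hn⟩
  · exact ⟨fun h' => absurd (this.mpr h) h'.not_gt, fun h' => absurd h' h.not_gt⟩

end RootData

open Classical in
/-- The number of elements of `R` which decrease the length of `x` by left multiplication. -/
noncomputable def inversionCount (cs : CoxeterSystem M W) (R : Finset W) (x : W) : ℕ :=
  (R.filter fun r => cs.length (r * x) < cs.length x).card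

namespace RootData
variable {cs : CoxeterSystem M W} {V : Type*} [AddCommGroup V] [Module ℝ V] (D : RootData cs V)
include D

open Classical in
theorem inversionCount_mul {R : Finset W} (hR : ∀ r ∈ R, cs.IsReflection r) {t : W} (htR : t ∈ R)
    (hconj : ∀ r ∈ R, t * r * t ∈ R) {x : W} (hx : cs.length x < cs.length (t * x)) :
    inversionCount cs R (t * x) = inversionCount cs R x + 1 +
      (R.filter fun r => r ≠ t ∧ D.act t (D.root r) = -D.root (t * r * t) ∧
        cs.length x < cs.length (r * x) ∧ cs.length x < cs.length (t * r * t * x)).card := by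
  have ht := hR t htR
  have hti := ht.inv
  have htt := ht.mul_self
  set e : W → W → ℤ := fun z r => if cs.length (r * z) < cs.length z then 1 else 0 with he
  have hcount : ∀ z, (inversionCount cs R z : ℤ) = e z t + ∑ r ∈ R.erase t, e z r := by
    intro z
    rw [Finset.add_sum_erase R _ htR, inversionCount, Finset.card_filter]
    push_cast
    rfl
  have hK : (R.filter fun r => r ≠ t ∧ D.act t (D.root r) = -D.root (t * r * t) ∧
        cs.length x < cs.length (r * x) ∧ cs.length x < cs.length (t * r * t * x))
      = ((R.erase t).filter fun r => D.act t (D.root r) = -D.root (t * r * t) ∧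
        cs.length x < cs.length (r * x) ∧ cs.length x < cs.length (t * r * t * x)) := by
    ext r; simp only [Finset.mem_filter, Finset.mem_erase]; tauto
  have htwice : ∀ r : W, t * (t * r * t) * t = r := by
    intro r
    calc t * (t * r * t) * t = (t * t) * r * (t * t) := by group
      _ = r := by rw [htt]; simp
  have hreindex : ∀ f : W → ℤ, ∑ r ∈ R.erase t, f (t * r * t) = ∑ r ∈ R.erase t, f r := by
    intro f
    have hm : ∀ r ∈ R.erase t, t * r * t ∈ R.erase t := by
      intro r hr
      rw [Finset.mem_erase] at hr ⊢
      refine ⟨fun h => hr.1 ?_, hconj r hr.2⟩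
      have := htwice r
      rw [h, htt, one_mul] at this
      exact this.symm
    exact Finset.sum_nbij' (fun r => t * r * t) (fun r => t * r * t) hm hm
      (fun r _ => htwice r) (fun r _ => htwice r) (fun r _ => rfl)
  have hact : ∀ v, D.act (t * x)⁻¹ v = D.act x⁻¹ (D.act t v) := by
    intro v; rw [D.act_act, mul_inv_rev, hti]
  have hterm : ∀ r ∈ R.erase t, e (t * x) (t * r * t) + e (t * x) r - e x r - e x (t * r * t)
      = 2 * (if D.act t (D.root r) = -D.root (t * r * t) ∧
        cs.length x < cs.length (r * x) ∧ cs.length x < cs.length (t * r * t * x)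
        then 1 else 0) := by
    intro r hr
    rw [Finset.mem_erase] at hr
    have hr1 := hR r hr.2
    have hr2 := hR _ (hconj r hr.2)
    have hinv : D.act t (D.act t (D.root r)) = D.root r := by rw [D.act_act, htt]; simp
    simp only [he, D.gt_iff_height_neg hr1, D.gt_iff_height_neg hr2, D.lt_iff_height_pos hr1,
      D.lt_iff_height_pos hr2, hact]
    have hn1 : D.height (D.act x⁻¹ (D.root r)) ≠ 0 := by
      rcases lt_or_gt_of_ne (hr1.length_mul_right_ne x) with h | h
      · exact ((D.gt_iff_height_neg hr1 x).mp h).ne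
      · exact ((D.lt_iff_height_pos hr1 x).mp h).ne'
    have hn2 : D.height (D.act x⁻¹ (D.root (t * r * t))) ≠ 0 := by
      rcases lt_or_gt_of_ne (hr2.length_mul_right_ne x) with h | h
      · exact ((D.gt_iff_height_neg hr2 x).mp h).ne
      · exact ((D.lt_iff_height_pos hr2 x).mp h).ne'
    have hpm := D.act_root_eq_or hr1 t
    rw [hti] at hpm
    by_cases hm : D.act t (D.root r) = -D.root (t * r * t)
    · have hm' : D.act t (D.root (t * r * t)) = -D.root r := by
        rw [hm, map_neg, neg_eq_iff_eq_neg] at hinv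
        exact hinv
      have hsum : D.root r + D.root (t * r * t) = D.form (D.root t) (D.root r) • D.root t := by
        have := D.act_reflection ht (D.root r)
        rw [hm] at this
        rw [← neg_neg (D.root (t * r * t)), this]; abel
      have hpos : 0 < D.form (D.root t) (D.root r) := by
        have h1 := congrArg D.height hsum
        rw [map_add, map_smul, smul_eq_mul] at h1
        have := D.height_pos hr1
        have := D.height_pos hr2
        exact pos_of_mul_pos_left (by linarith) (D.height_pos ht).le
      have hsum' := congrArg (fun v => D.height (D.act x⁻¹ v)) hsum
      simp only [map_add, map_smul, smul_eq_mul] at hsum'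
      have := mul_pos hpos ((D.lt_iff_height_pos ht x).mp hx)
      simp only [hm, hm', map_neg, neg_lt_zero, true_and]
      rcases lt_or_gt_of_ne hn1 with h1 | h1 <;> rcases lt_or_gt_of_ne hn2 with h2 | h2
      · linarith
      · simp [h1, h2, h1.not_gt, h2.not_gt]
      · simp [h1, h2, h1.not_gt, h2.not_gt]
      · simp [h1, h2, h1.not_gt, h2.not_gt]
    · have hp := hpm.resolve_right hm
      have hp' : D.act t (D.root (t * r * t)) = D.root r := by rw [← hp]; exact hinv
      simp only [hp', hp, if_neg (fun h => hm (hp.trans h.1) : ¬ (D.root (t * r * t) =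
        -D.root (t * r * t) ∧ _))]
      ring
  have e1 : e (t * x) t = 1 := by
    simp only [he]; rw [← mul_assoc, htt, one_mul, if_pos hx]
  have e0 : e x t = 0 := by simp only [he]; rw [if_neg hx.not_gt]
  have hs := Finset.sum_congr rfl hterm
  simp only [Finset.sum_sub_distrib, Finset.sum_add_distrib, ← Finset.mul_sum] at hs
  rw [hreindex (e (t * x)), hreindex (e x)] at hs
  have hcard : ((((R.erase t).filter fun r => D.act t (D.root r) = -D.root (t * r * t) ∧
        cs.length x < cs.length (r * x) ∧ cs.length x < cs.length (t * r * t * x)).card : ℕ) : ℤ)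
      = ∑ r ∈ R.erase t, (if D.act t (D.root r) = -D.root (t * r * t) ∧
        cs.length x < cs.length (r * x) ∧ cs.length x < cs.length (t * r * t * x)
        then 1 else 0) := by
    rw [Finset.card_filter]; push_cast; rfl
  rw [hK]
  rw [← Nat.cast_inj (R := ℤ), Nat.cast_add, Nat.cast_add, Nat.cast_one,
    hcount, hcount, hcard, e1, e0]
  linarith

end RootData

/-! ### Planes spanned by two roots -/

namespace RootData
variable {cs : CoxeterSystem M W} {V : Type*} [AddCommGroup V] [Module ℝ V] (D : RootData cs V)

open Classical in
/-- The reflections whose roots lie in the plane spanned by the roots of `a` and `b`. -/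
noncomputable def plane [Finite W] (a b : W) : Finset W :=
  (Set.toFinite {r : W | cs.IsReflection r ∧
    D.root r ∈ Submodule.span ℝ {D.root a, D.root b}}).toFinset

theorem mem_plane [Finite W] {a b r : W} : r ∈ D.plane a b ↔
    cs.IsReflection r ∧ D.root r ∈ Submodule.span ℝ {D.root a, D.root b} := by
  simp [plane]

theorem left_mem_plane [Finite W] {a : W} (b : W) (ha : cs.IsReflection a) : a ∈ D.plane a b :=
  D.mem_plane.mpr ⟨ha, Submodule.subset_span (by simp)⟩

theorem right_mem_plane [Finite W] (a : W) {b : W} (hb : cs.IsReflection b) : b ∈ D.plane a b :=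
  D.mem_plane.mpr ⟨hb, Submodule.subset_span (by simp)⟩

theorem conj_mem_plane [Finite W] {a b r t : W} (ht : t ∈ D.plane a b) (hr : r ∈ D.plane a b) :
    t * r * t ∈ D.plane a b := by
  rw [mem_plane] at *
  have hti := ht.1.inv
  have hc := hr.1.conj t
  have h := D.act_root_eq_or hr.1 t
  rw [hti] at hc h
  refine ⟨hc, ?_⟩
  have hm : D.act t (D.root r) ∈ Submodule.span ℝ {D.root a, D.root b} := by
    rw [D.act_reflection ht.1]
    exact Submodule.sub_mem _ hr.2 (Submodule.smul_mem _ _ ht.2)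
  rcases h with h | h
  · rwa [← h]
  · rw [← neg_neg (D.root (t * r * t)), ← h]
    exact Submodule.neg_mem _ hm

theorem eq_zero_of_smul_add_smul_eq_zero {a b : W} (ha : cs.IsReflection a)
    (hb : cs.IsReflection b) (hab : a ≠ b) {x y : ℝ}
    (h : x • D.root a + y • D.root b = 0) : x = 0 ∧ y = 0 := by
  have key : ∀ {a b : W}, cs.IsReflection a → cs.IsReflection b → a ≠ b → ∀ {x y : ℝ},
      x • D.root a + y • D.root b = 0 → x = 0 := by
    intro a b ha hb hab x y h
    by_contra hx
    refine hab (D.eq_of_root_eq_smul ha hb (c := -(x⁻¹ * y)) ?_)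
    have h2 := congrArg (fun v => x⁻¹ • v) h
    simp only [smul_add, smul_smul, inv_mul_cancel₀ hx, one_smul, smul_zero] at h2
    rw [neg_smul]
    exact eq_neg_of_add_eq_zero_left h2
  exact ⟨key ha hb hab h, key hb ha hab.symm (by rwa [add_comm] at h)⟩

/-- Distinct reflections generate a finite dihedral group, so their roots span a nondegenerate
plane. -/
theorem four_sub_sq_ne_zero [Finite W] {a b : W} (ha : cs.IsReflection a)
    (hb : cs.IsReflection b) (hab : a ≠ b) :
    4 - D.form (D.root a) (D.root b) ^ 2 ≠ 0 := by
  intro h0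
  set c := D.form (D.root a) (D.root b) with hc
  set γ := D.root a - (c / 2) • D.root b with hγ
  have hc4 : c * c = 4 := by linarith
  have haa := D.form_root_self ha
  have hbb := D.form_root_self hb
  have hba : D.form (D.root b) (D.root a) = c := D.form_symm _ _
  have fa : D.form (D.root a) γ = 0 := by
    rw [hγ, map_sub, map_smul, haa, ← hc, smul_eq_mul]; linarith
  have fb : D.form (D.root b) γ = 0 := by
    rw [hγ, map_sub, map_smul, hbb, hba, smul_eq_mul]; linarith
  have ga : D.act (a * b) γ = γ := by
    rw [← D.act_act, D.act_reflection hb, fb, zero_smul, sub_zero, D.act_reflection ha, fa,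
      zero_smul, sub_zero]
  have aa : D.act (a * b) (D.root a) = D.root a + (2 : ℝ) • γ := by
    rw [← D.act_act, D.act_reflection hb, hba, map_sub, map_smul, D.act_reflection ha,
      D.act_reflection ha, haa, ← hc, hγ]
    match_scalars
    · linarith
    · ring
  have hpow : ∀ n : ℕ, D.act ((a * b) ^ n) (D.root a) = D.root a + (2 * n : ℝ) • γ := by
    intro n
    induction n with
    | zero => simp
    | succ n ih =>
      rw [pow_succ', ← D.act_act, ih, map_add, map_smul, ga, aa]
      push_cast
      module
  have h1 := hpow (Nat.card W)
  rw [pow_card_eq_one', map_one, Module.End.one_apply, left_eq_add, smul_eq_zero] at h1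
  have hγ0 : γ = 0 := h1.resolve_left (by simp [Nat.card_pos.ne'])
  refine hab (D.eq_of_root_eq_smul ha hb (c := c / 2) ?_)
  rwa [hγ, sub_eq_zero] at hγ0

/-- A finite set of at least two positive roots in a plane has two extreme rays. -/
theorem exists_extreme [Finite W] {a b : W} (ha : cs.IsReflection a)
    (hb : cs.IsReflection b) (hab : a ≠ b) {S : Finset W} (hS : S ⊆ D.plane a b)
    (hcard : 2 ≤ S.card) :
    ∃ r₁ ∈ S, ∃ r₂ ∈ S, r₁ ≠ r₂ ∧ ∀ r ∈ S, ∃ p q : ℝ, 0 ≤ p ∧ 0 ≤ q ∧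
      D.root r = p • D.root r₁ + q • D.root r₂ := by
  set c := D.form (D.root a) (D.root b) with hc
  have hc0 := D.four_sub_sq_ne_zero ha hb hab
  rw [← hc] at hc0
  set θ : V →ₗ[ℝ] ℝ := (2 : ℝ) • D.form (D.root b) - c • D.form (D.root a) with hθ
  have hθa : θ (D.root a) = 0 := by
    simp only [hθ, LinearMap.sub_apply, LinearMap.smul_apply, smul_eq_mul, D.form_root_self ha]
    rw [D.form_symm, ← hc]; ring
  have hθb : θ (D.root b) = 4 - c ^ 2 := by
    simp only [hθ, LinearMap.sub_apply, LinearMap.smul_apply, smul_eq_mul, D.form_root_self hb]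
    rw [← hc]; ring
  have hker : ∀ v ∈ Submodule.span ℝ {D.root a, D.root b}, θ v = 0 → D.height v = 0 → v = 0 := by
    intro v hv h1 h2
    obtain ⟨p, q, rfl⟩ := Submodule.mem_span_pair.mp hv
    rw [map_add, map_smul, map_smul, hθa, hθb, smul_zero, zero_add, smul_eq_mul] at h1
    have hq := (mul_eq_zero.mp h1).resolve_right hc0
    rw [hq, zero_smul, add_zero, map_smul, smul_eq_mul] at h2
    have hp := (mul_eq_zero.mp h2).resolve_right (D.height_pos ha).ne'
    rw [hp, hq]; simp
  have hpos : ∀ r ∈ S, 0 < D.height (D.root r) := fun r hr =>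
    D.height_pos (D.mem_plane.mp (hS hr)).1
  have hspan : ∀ r ∈ S, D.root r ∈ Submodule.span ℝ {D.root a, D.root b} := fun r hr =>
    (D.mem_plane.mp (hS hr)).2
  have hne : S.Nonempty := Finset.card_pos.mp (by omega)
  obtain ⟨r₁, h₁, hmin⟩ := S.exists_min_image (fun r => θ (D.root r) / D.height (D.root r)) hne
  obtain ⟨r₂, h₂, hmax⟩ := S.exists_max_image (fun r => θ (D.root r) / D.height (D.root r)) hne
  have hmin' : ∀ r ∈ S, 0 ≤ θ (D.root r) * D.height (D.root r₁) -
      θ (D.root r₁) * D.height (D.root r) := fun r hr => by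
    have := hmin r hr
    rw [div_le_div_iff₀ (hpos _ h₁) (hpos _ hr)] at this
    linarith
  have hmax' : ∀ r ∈ S, 0 ≤ θ (D.root r₂) * D.height (D.root r) -
      θ (D.root r) * D.height (D.root r₂) := fun r hr => by
    have := hmax r hr
    rw [div_le_div_iff₀ (hpos _ hr) (hpos _ h₂)] at this
    linarith
  have hinj : ∀ r ∈ S, ∀ r' ∈ S, θ (D.root r) * D.height (D.root r') =
      θ (D.root r') * D.height (D.root r) → r = r' := by
    intro r hr r' hr' h
    have h0 := hker (D.height (D.root r') • D.root r - D.height (D.root r) • D.root r')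
      (Submodule.sub_mem _ (Submodule.smul_mem _ _ (hspan r hr))
        (Submodule.smul_mem _ _ (hspan r' hr')))
      (by simp only [map_sub, map_smul, smul_eq_mul]; linarith)
      (by simp only [map_sub, map_smul, smul_eq_mul]; ring)
    by_contra hrr
    refine (hpos r' hr').ne' (D.eq_zero_of_smul_add_smul_eq_zero
      (D.mem_plane.mp (hS hr)).1 (D.mem_plane.mp (hS hr')).1 hrr
      (x := D.height (D.root r')) (y := -D.height (D.root r)) ?_).1
    rw [neg_smul, ← sub_eq_add_neg, h0]
  have h12 : r₁ ≠ r₂ := by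
    rintro rfl
    obtain ⟨r, hr, r', hr', hrr⟩ := Finset.one_lt_card.mp (show 1 < S.card by omega)
    have key : ∀ r ∈ S, r = r₁ := fun r hr =>
      hinj r hr r₁ h₁ (by linarith [hmin' r hr, hmax' r hr])
    exact hrr ((key r hr).trans (key r' hr').symm)
  have hD : 0 < θ (D.root r₂) * D.height (D.root r₁) - θ (D.root r₁) * D.height (D.root r₂) :=
    lt_of_le_of_ne (hmin' r₂ h₂) fun h => h12 (hinj r₁ h₁ r₂ h₂ (by linarith))
  refine ⟨r₁, h₁, r₂, h₂, h12, fun r hr => ⟨_, _, div_nonneg (hmax' r hr) hD.le,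
    div_nonneg (hmin' r hr) hD.le, ?_⟩⟩
  have hD0 := mul_inv_cancel₀ hD.ne'
  rw [← sub_eq_zero]
  refine hker _ (Submodule.sub_mem _ (hspan r hr) (Submodule.add_mem _
    (Submodule.smul_mem _ _ (hspan _ h₁)) (Submodule.smul_mem _ _ (hspan _ h₂)))) ?_ ?_
  · simp only [map_sub, map_add, map_smul, smul_eq_mul, div_eq_mul_inv]
    linear_combination (-θ (D.root r)) * hD0
  · simp only [map_sub, map_add, map_smul, smul_eq_mul, div_eq_mul_inv]
    linear_combination (-D.height (D.root r)) * hD0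

/-- An extreme root is not a positive combination of two other roots. -/
theorem eq_of_add_eq_smul {r₁ r₂ r r' : W} (h₁ : cs.IsReflection r₁)
    (h₂ : cs.IsReflection r₂) (h12 : r₁ ≠ r₂) (hr : cs.IsReflection r) {p q p' q' k : ℝ}
    (hq : 0 ≤ q) (hq' : 0 ≤ q') (h : D.root r = p • D.root r₁ + q • D.root r₂)
    (h' : D.root r' = p' • D.root r₁ + q' • D.root r₂)
    (hk : D.root r + D.root r' = k • D.root r₁) : r = r₁ := by
  have h0 : (p + p' - k) • D.root r₁ + (q + q') • D.root r₂ = 0 := by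
    rw [h, h'] at hk
    rw [← sub_eq_zero] at hk
    rw [← hk]; module
  have := (D.eq_zero_of_smul_add_smul_eq_zero h₁ h₂ h12 h0).2
  have hq0 : q = 0 := by linarith
  rw [hq0, zero_smul, add_zero] at h
  exact D.eq_of_root_eq_smul hr h₁ h

section
variable [Finite W]

theorem inversionCount_plane_mul {a b t x : W} (ht : t ∈ D.plane a b)
    (hx : cs.length x < cs.length (t * x)) :
    inversionCount cs (D.plane a b) x + 1 ≤ inversionCount cs (D.plane a b) (t * x) := by
  rw [D.inversionCount_mul (fun r hr => (D.mem_plane.mp hr).1) ht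
    (fun r hr => D.conj_mem_plane ht hr) hx]
  omega

theorem length_lt_of_inversionCount_lt {a b r x : W} (hr : r ∈ D.plane a b)
    (h : inversionCount cs (D.plane a b) x < inversionCount cs (D.plane a b) (r * x)) :
    cs.length x < cs.length (r * x) := by
  have hrr := (D.mem_plane.mp hr).1
  by_contra h'
  have h2 := lt_of_le_of_ne (not_lt.mp h') (hrr.length_mul_right_ne x)
  have := D.inversionCount_plane_mul hr (x := r * x)
    (by rwa [← mul_assoc, hrr.mul_self, one_mul])
  rw [← mul_assoc, hrr.mul_self, one_mul] at this
  omega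

open Classical in
theorem exists_two_up {a b : W} (ha : cs.IsReflection a) (hb : cs.IsReflection b) (hab : a ≠ b)
    {x : W} (hcard : 2 ≤ ((D.plane a b).filter fun r => cs.length x < cs.length (r * x)).card) :
    ∃ r₁ ∈ D.plane a b, ∃ r₂ ∈ D.plane a b, r₁ ≠ r₂ ∧
      inversionCount cs (D.plane a b) (r₁ * x) = inversionCount cs (D.plane a b) x + 1 ∧
      inversionCount cs (D.plane a b) (r₂ * x) = inversionCount cs (D.plane a b) x + 1 := by
  obtain ⟨r₁, h₁, r₂, h₂, h12, hall⟩ :=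
    D.exists_extreme ha hb hab (Finset.filter_subset _ _) hcard
  have key : ∀ r₁ r₂ : W, r₁ ∈ D.plane a b → r₂ ∈ D.plane a b → r₁ ≠ r₂ →
      cs.length x < cs.length (r₁ * x) →
      (∀ r ∈ (D.plane a b).filter fun r => cs.length x < cs.length (r * x),
        ∃ p q : ℝ, 0 ≤ p ∧ 0 ≤ q ∧ D.root r = p • D.root r₁ + q • D.root r₂) →
      inversionCount cs (D.plane a b) (r₁ * x) = inversionCount cs (D.plane a b) x + 1 := by
    intro r₁ r₂ h₁ h₂ h12 hx hall
    rw [D.inversionCount_mul (fun r hr => (D.mem_plane.mp hr).1) h₁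
      (fun r hr => D.conj_mem_plane h₁ hr) hx, Nat.add_eq_left, Finset.card_eq_zero,
      Finset.filter_eq_empty_iff]
    rintro r hr ⟨hne, hm, hu, hu'⟩
    obtain ⟨p, q, -, hq, e⟩ := hall r (Finset.mem_filter.mpr ⟨hr, hu⟩)
    obtain ⟨p', q', -, hq', e'⟩ :=
      hall _ (Finset.mem_filter.mpr ⟨D.conj_mem_plane h₁ hr, hu'⟩)
    refine hne (D.eq_of_add_eq_smul (D.mem_plane.mp h₁).1 (D.mem_plane.mp h₂).1 h12
      (D.mem_plane.mp hr).1 hq hq' e e' (k := D.form (D.root r₁) (D.root r)) ?_)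
    rw [D.act_reflection (D.mem_plane.mp h₁).1, ← sub_eq_zero] at hm
    rw [← sub_eq_zero, ← hm]; abel
  rw [Finset.mem_filter] at h₁ h₂
  refine ⟨r₁, h₁.1, r₂, h₂.1, h12, key r₁ r₂ h₁.1 h₂.1 h12 h₁.2 hall,
    key r₂ r₁ h₂.1 h₁.1 h12.symm h₂.2 fun r hr => ?_⟩
  obtain ⟨p, q, hp, hq, e⟩ := hall r hr
  exact ⟨q, p, hq, hp, by rw [e, add_comm]⟩

open Classical in
theorem exists_two_down {a b : W} (ha : cs.IsReflection a) (hb : cs.IsReflection b) (hab : a ≠ b)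
    {y : W} (hcard : 2 ≤ inversionCount cs (D.plane a b) y) :
    ∃ r₁ ∈ D.plane a b, ∃ r₂ ∈ D.plane a b, r₁ ≠ r₂ ∧
      inversionCount cs (D.plane a b) y = inversionCount cs (D.plane a b) (r₁ * y) + 1 ∧
      inversionCount cs (D.plane a b) y = inversionCount cs (D.plane a b) (r₂ * y) + 1 := by
  obtain ⟨r₁, h₁, r₂, h₂, h12, hall⟩ :=
    D.exists_extreme ha hb hab (Finset.filter_subset _ _) hcard
  have key : ∀ r₁ r₂ : W, r₁ ∈ D.plane a b → r₂ ∈ D.plane a b → r₁ ≠ r₂ →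
      cs.length (r₁ * y) < cs.length y →
      (∀ r ∈ (D.plane a b).filter fun r => cs.length (r * y) < cs.length y,
        ∃ p q : ℝ, 0 ≤ p ∧ 0 ≤ q ∧ D.root r = p • D.root r₁ + q • D.root r₂) →
      inversionCount cs (D.plane a b) y = inversionCount cs (D.plane a b) (r₁ * y) + 1 := by
    intro r₁ r₂ h₁ h₂ h12 hy hall
    have hr₁ := (D.mem_plane.mp h₁).1
    have hyy : r₁ * (r₁ * y) = y := by rw [← mul_assoc, hr₁.mul_self, one_mul]
    have hform := D.inversionCount_mul (fun r hr => (D.mem_plane.mp hr).1) h₁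
      (fun r hr => D.conj_mem_plane h₁ hr) (x := r₁ * y) (by rwa [hyy])
    rw [hyy] at hform
    rw [hform, Nat.add_eq_left, Finset.card_eq_zero, Finset.filter_eq_empty_iff]
    rintro r hr ⟨hne, hm, hu, hu'⟩
    have hc := D.conj_mem_plane h₁ hr
    have hm' : D.act r₁ (D.root (r₁ * r * r₁)) = -D.root r := by
      rw [← neg_eq_iff_eq_neg, ← map_neg, ← hm, D.act_act, hr₁.mul_self]; simp
    have down : ∀ {s s' : W}, cs.IsReflection s → cs.IsReflection s' →
        D.act r₁ (D.root s) = -D.root s' → cs.length (r₁ * y) < cs.length (s * (r₁ * y)) →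
        cs.length (s' * y) < cs.length y := by
      intro s s' hs hs' e h
      rw [D.lt_iff_height_pos hs, mul_inv_rev, hr₁.inv, ← D.act_act, e, map_neg, map_neg] at h
      rw [D.gt_iff_height_neg hs']
      linarith
    obtain ⟨p, q, -, hq, e⟩ := hall r (Finset.mem_filter.mpr ⟨hr,
      down (D.mem_plane.mp hc).1 (D.mem_plane.mp hr).1 hm' hu'⟩)
    obtain ⟨p', q', -, hq', e'⟩ := hall _ (Finset.mem_filter.mpr ⟨hc,
      down (D.mem_plane.mp hr).1 (D.mem_plane.mp hc).1 hm hu⟩)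
    refine hne (D.eq_of_add_eq_smul (D.mem_plane.mp h₁).1 (D.mem_plane.mp h₂).1 h12
      (D.mem_plane.mp hr).1 hq hq' e e' (k := D.form (D.root r₁) (D.root r)) ?_)
    rw [D.act_reflection (D.mem_plane.mp h₁).1, ← sub_eq_zero] at hm
    rw [← sub_eq_zero, ← hm]; abel
  rw [Finset.mem_filter] at h₁ h₂
  refine ⟨r₁, h₁.1, r₂, h₂.1, h12, key r₁ r₂ h₁.1 h₂.1 h12 h₁.2 hall,
    key r₂ r₁ h₂.1 h₁.1 h12.symm h₂.2 fun r hr => ?_⟩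
  obtain ⟨p, q, hp, hq, e⟩ := hall r hr
  exact ⟨q, p, hq, hp, by rw [e, add_comm]⟩

end
end RootData

section
variable {G : Type*} [Group G] {a b : G}

theorem mul_zpow_mul_of_mul_self (ha : a * a = 1) (hb : b * b = 1) (n : ℤ) :
    a * (a * b) ^ n = (a * b) ^ (-n) * a := by
  have h : SemiconjBy a (a * b) (a * b)⁻¹ := by
    rw [SemiconjBy, mul_inv_rev, inv_eq_of_mul_eq_one_left ha, inv_eq_of_mul_eq_one_left hb,
      ← mul_assoc, ha, one_mul, mul_assoc, ha, mul_one]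
  rw [(h.zpow_right n).eq, inv_zpow, zpow_neg]

theorem eq_zpow_neg_one_mul_of_mul_self (ha : a * a = 1) (hb : b * b = 1) :
    b = (a * b) ^ (-1 : ℤ) * a := by
  rw [zpow_neg_one, mul_inv_rev, inv_eq_of_mul_eq_one_left ha, inv_eq_of_mul_eq_one_left hb,
    mul_assoc, ha, mul_one]

theorem conj_right_zpow_mul_of_mul_self (ha : a * a = 1) (hb : b * b = 1) (n : ℤ) :
    b * ((a * b) ^ n * a) * b = (a * b) ^ (-n - 2) * a := by
  have hb' := eq_zpow_neg_one_mul_of_mul_self ha hb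
  rw [show -n - 2 = -1 + -n + -1 by ring]
  nth_rewrite 3 [hb']
  nth_rewrite 1 [hb']
  simp only [mul_assoc]
  rw [← mul_assoc a (_ ^ n), mul_zpow_mul_of_mul_self ha hb]
  simp only [mul_assoc, zpow_add]
  rw [← mul_assoc a a, ha, one_mul]

end

namespace RootData
variable {cs : CoxeterSystem M W} {V : Type*} [AddCommGroup V] [Module ℝ V] (D : RootData cs V)
variable [Finite W]

/-- All reflections of `W` with roots in a plane are of the form `(a₀ b₀) ^ n * a₀`. -/
theorem exists_plane_eq_zpow_mul {a b : W} (ha : cs.IsReflection a) (hb : cs.IsReflection b)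
    (hab : a ≠ b) : ∃ a₀ ∈ D.plane a b, ∃ b₀ ∈ D.plane a b,
      ∀ r ∈ D.plane a b, ∃ n : ℤ, r = (a₀ * b₀) ^ n * a₀ := by
  classical
  obtain ⟨a₀, h₁, b₀, h₂, h12, hall⟩ := D.exists_extreme ha hb hab subset_rfl
    (Finset.one_lt_card.mpr ⟨a, D.left_mem_plane b ha, b, D.right_mem_plane a hb, hab⟩)
  have hr₁ := (D.mem_plane.mp h₁).1
  have hr₂ := (D.mem_plane.mp h₂).1
  have haa := hr₁.mul_self
  have hbb := hr₂.mul_self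
  have hz := mul_zpow_mul_of_mul_self haa hbb
  have hb₀ := eq_zpow_neg_one_mul_of_mul_self haa hbb
  refine ⟨a₀, h₁, b₀, h₂, ?_⟩
  by_contra! hbad
  have hne : ((D.plane a b).filter fun r => ∀ n : ℤ, r ≠ (a₀ * b₀) ^ n * a₀).Nonempty := by
    obtain ⟨r, hr, h⟩ := hbad
    exact ⟨r, Finset.mem_filter.mpr ⟨hr, h⟩⟩
  obtain ⟨r, hr, hmin⟩ := Finset.exists_min_image _ (fun r => D.height (D.root r)) hne
  obtain ⟨hrp, hrn⟩ := Finset.mem_filter.mp hr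
  have hrr := (D.mem_plane.mp hrp).1
  obtain ⟨p, q, hp, hq, e⟩ := hall r hrp
  have key : ∀ c d : W, c ∈ D.plane a b → d ∈ D.plane a b → c ≠ d → r ≠ c →
      (∀ r ∈ D.plane a b, ∃ p q : ℝ, 0 ≤ p ∧ 0 ≤ q ∧
        D.root r = p • D.root c + q • D.root d) →
      0 < D.form (D.root c) (D.root r) →
      ∃ n : ℤ, c * r * c = (a₀ * b₀) ^ n * a₀ := by
    intro c d hc hd hcd hrc hall hpos
    have hcr := (D.mem_plane.mp hc).1
    have hcon := D.conj_mem_plane hc hrp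
    by_contra! hgood
    have hle := hmin _ (Finset.mem_filter.mpr ⟨hcon, hgood⟩)
    have h := D.act_root_eq_or hrr c
    rw [hcr.inv, D.act_reflection hcr] at h
    rcases h with h | h
    · have := congrArg D.height h
      rw [map_sub, map_smul, smul_eq_mul] at this
      nlinarith [D.height_pos hcr]
    · obtain ⟨p, q, -, hq, e⟩ := hall r hrp
      obtain ⟨p', q', -, hq', e'⟩ := hall _ hcon
      refine hrc (D.eq_of_add_eq_smul hcr (D.mem_plane.mp hd).1 hcd hrr hq hq' e e'
        (k := D.form (D.root c) (D.root r)) ?_)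
      rw [← sub_eq_zero] at h ⊢
      rw [← h]; abel
  have hback : ∀ c : W, cs.IsReflection c → r = c * (c * r * c) * c := fun c hc => by
    simp [mul_assoc, hc.mul_self, ← mul_assoc c c]
  have h2 := D.form_root_self hrr
  nth_rewrite 1 [e] at h2
  simp only [map_add, map_smul, LinearMap.add_apply, LinearMap.smul_apply, smul_eq_mul] at h2
  rcases lt_or_ge 0 (D.form (D.root a₀) (D.root r)) with h | h
  · obtain ⟨n, hn⟩ := key a₀ b₀ h₁ h₂ h12 (fun h => hrn 0 (by simpa using h)) hall h
    refine hrn (-n) ?_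
    rw [hback a₀ hr₁, hn, ← mul_assoc, hz, mul_assoc, mul_assoc, haa, mul_one]
  rcases lt_or_ge 0 (D.form (D.root b₀) (D.root r)) with h' | h'
  · obtain ⟨n, hn⟩ := key b₀ a₀ h₂ h₁ h12.symm (fun h => hrn (-1) (h.trans hb₀))
      (fun r hr => by
        obtain ⟨p, q, hp, hq, e⟩ := hall r hr
        exact ⟨q, p, hq, hp, by rw [e, add_comm]⟩) h'
    exact hrn (-n - 2) (by rw [hback b₀ hr₂, hn, conj_right_zpow_mul_of_mul_self haa hbb])
  · nlinarith

/-- A product of three reflections of `W` with roots in a common plane is again one. -/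
theorem mul_mul_mem_plane {a b : W} (ha : cs.IsReflection a) (hb : cs.IsReflection b)
    (hab : a ≠ b) {r₁ r₂ r₃ : W} (h₁ : r₁ ∈ D.plane a b) (h₂ : r₂ ∈ D.plane a b)
    (h₃ : r₃ ∈ D.plane a b) : r₁ * r₂ * r₃ ∈ D.plane a b := by
  obtain ⟨a₀, ha₀, b₀, hb₀, hall⟩ := D.exists_plane_eq_zpow_mul ha hb hab
  have hr₁ := (D.mem_plane.mp ha₀).1
  have hr₂ := (D.mem_plane.mp hb₀).1
  have haa := hr₁.mul_self
  have hbb := hr₂.mul_self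
  have hz := mul_zpow_mul_of_mul_self haa hbb
  have hb' := eq_zpow_neg_one_mul_of_mul_self haa hbb
  have hneg : ∀ n : ℤ, (a₀ * b₀) ^ n * a₀ ∈ D.plane a b → (a₀ * b₀) ^ (-n) * a₀ ∈ D.plane a b := by
    intro n h
    have := D.conj_mem_plane ha₀ h
    rwa [← mul_assoc, hz, mul_assoc, mul_assoc, haa, mul_one] at this
  have hneg' : ∀ n : ℤ, (a₀ * b₀) ^ n * a₀ ∈ D.plane a b →
      (a₀ * b₀) ^ (-n - 2) * a₀ ∈ D.plane a b := by
    intro n h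
    have := D.conj_mem_plane hb₀ h
    rwa [conj_right_zpow_mul_of_mul_self haa hbb] at this
  have hmem : ∀ n : ℤ, (a₀ * b₀) ^ n * a₀ ∈ D.plane a b ∧
      (a₀ * b₀) ^ (n + 1) * a₀ ∈ D.plane a b := by
    intro n
    induction n with
    | zero =>
      refine ⟨by simpa using ha₀, ?_⟩
      have := hneg (-1) (hb' ▸ hb₀)
      simpa using this
    | succ n ih =>
      refine ⟨ih.2, ?_⟩
      have := hneg _ (hneg' _ ih.1)
      rwa [show -(-(n : ℤ) - 2) = (n : ℤ) + 1 + 1 by ring] at this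
    | pred n ih =>
      refine ⟨?_, by simpa using ih.1⟩
      have := hneg' _ (hneg _ ih.2)
      rwa [show -(-(-(n : ℤ) + 1)) - 2 = -(n : ℤ) - 1 by ring] at this
  obtain ⟨k, rfl⟩ := hall _ h₁
  obtain ⟨l, rfl⟩ := hall _ h₂
  obtain ⟨n, rfl⟩ := hall _ h₃
  have e : (a₀ * b₀) ^ k * a₀ * ((a₀ * b₀) ^ l * a₀) * ((a₀ * b₀) ^ n * a₀) =
      (a₀ * b₀) ^ (k + -l + n) * a₀ := by
    simp only [mul_assoc, zpow_add]
    rw [← mul_assoc a₀ (_ ^ l), hz]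
    simp only [mul_assoc]
    rw [← mul_assoc a₀ a₀, haa, one_mul]
  rw [e]
  exact (hmem _).1

end RootData

/-! ### The Bruhat graph -/

/-- Adjacency in the Bruhat graph. -/
def BruhatAdj (cs : CoxeterSystem M W) (x y : W) : Prop := cs.IsReflection (y * x⁻¹)

section
variable {cs : CoxeterSystem M W}

theorem BruhatAdj.symm {x y : W} (h : BruhatAdj cs x y) : BruhatAdj cs y x := by
  have := h.isReflection_inv
  rwa [mul_inv_rev, inv_inv] at this

theorem bruhatAdj_mul {r : W} (hr : cs.IsReflection r) (x : W) : BruhatAdj cs x (r * x) := by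
  rwa [BruhatAdj, mul_inv_cancel_right]

theorem BruhatAdj.exists_eq_mul {x y : W} (h : BruhatAdj cs x y) :
    ∃ r, cs.IsReflection r ∧ y = r * x := ⟨_, h, by simp⟩

theorem BruhatAdj.inv_mul_eq {x y : W} (h : BruhatAdj cs x y) : x * y⁻¹ = y * x⁻¹ := by
  rw [← h.inv, mul_inv_rev, inv_inv]

end

namespace RootData
variable {cs : CoxeterSystem M W} {V : Type*} [AddCommGroup V] [Module ℝ V] (D : RootData cs V)
variable [Finite W]

include D in
theorem inversionCount_eq_length (x : W) :
    inversionCount cs (Set.toFinite {r : W | cs.IsReflection r}).toFinset x = cs.length x := by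
  classical
  set R := (Set.toFinite {r : W | cs.IsReflection r}).toFinset with hR
  have hmem : ∀ r, r ∈ R ↔ cs.IsReflection r := fun r => by simp [hR]
  have up : ∀ (i : B) (x : W), cs.length x < cs.length (cs.simple i * x) →
      inversionCount cs R (cs.simple i * x) = inversionCount cs R x + 1 := by
    intro i x hx
    have hi := cs.isReflection_simple i
    rw [D.inversionCount_mul (fun r hr => (hmem r).mp hr) ((hmem _).mpr hi)
      (fun r hr => (hmem _).mpr (by
        have := ((hmem r).mp hr).conj (cs.simple i)
        rwa [hi.inv] at this))
      hx, Nat.add_eq_left, Finset.card_eq_zero, Finset.filter_eq_empty_iff]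
    rintro r hr ⟨hne, hm, -⟩
    have hrr := (hmem r).mp hr
    have hlt : cs.length (cs.simple i * r) < cs.length (cs.simple i) := by
      by_contra h
      have h2 := lt_of_le_of_ne (not_lt.mp h) (hrr.length_mul_left_ne _).symm
      have h3 := D.act_root_of_lt hrr h2
      rw [hi.inv, hm] at h3
      have h4 := congrArg D.height h3
      have hc := hrr.conj (cs.simple i)
      rw [hi.inv] at hc
      have := D.height_pos hc
      rw [map_neg] at h4
      linarith
    rw [cs.length_simple, Nat.lt_one_iff, cs.length_eq_zero_iff] at hlt
    exact hne (by rw [← hi.inv]; exact (inv_eq_of_mul_eq_one_right hlt).symm)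
  induction x using cs.simple_induction_left with
  | one => rw [cs.length_one, inversionCount, Finset.card_eq_zero, Finset.filter_eq_empty_iff]; simp
  | mul_simple_left x i ih =>
    rcases cs.length_simple_mul x i with h | h
    · rw [up i x (by omega), ih, h]
    · have := up i (cs.simple i * x) (by rw [cs.simple_mul_simple_cancel_left]; omega)
      rw [cs.simple_mul_simple_cancel_left] at this
      omega

include D in
/-- Every edge of the Bruhat graph of height at least three spans a Bruhat interval containing two
disjoint pairs of intermediate elements in the coset of a dihedral reflection subgroup. -/
theorem exists_intermediate {x y : W} (hxy : BruhatAdj cs x y)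
    (hlen : cs.length x + 1 < cs.length y) :
    ∃ a b c d : W, a ≠ b ∧ c ≠ d ∧ BruhatAdj cs x a ∧ BruhatAdj cs x b ∧ BruhatAdj cs a c ∧
      BruhatAdj cs b c ∧ BruhatAdj cs a d ∧ BruhatAdj cs b d ∧ BruhatAdj cs c y ∧
      BruhatAdj cs d y ∧ cs.length x < cs.length a ∧ cs.length x < cs.length b ∧
      cs.length a < cs.length c ∧ cs.length b < cs.length c ∧ cs.length a < cs.length d ∧
      cs.length b < cs.length d ∧ cs.length c < cs.length y ∧ cs.length d < cs.length y := by
  classical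
  obtain ⟨t, ht, rfl⟩ := hxy.exists_eq_mul
  have htx : cs.length x < cs.length (t * x) := by omega
  have hcl : ∀ r ∈ (Set.toFinite {r : W | cs.IsReflection r}).toFinset,
      t * r * t ∈ (Set.toFinite {r : W | cs.IsReflection r}).toFinset := by
    intro r hr
    have := (show cs.IsReflection r by simpa using hr).conj t
    rw [ht.inv] at this
    simpa using this
  have hform := D.inversionCount_mul (fun r hr => by simpa using hr) (by simpa using ht) hcl htx
  rw [D.inversionCount_eq_length, D.inversionCount_eq_length] at hform
  obtain ⟨r, hrr, hrt, hm, hu, hu'⟩ : ∃ r, cs.IsReflection r ∧ r ≠ t ∧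
      D.act t (D.root r) = -D.root (t * r * t) ∧ cs.length x < cs.length (r * x) ∧
      cs.length x < cs.length (t * r * t * x) := by
    by_contra! h
    rw [Finset.card_eq_zero.mpr (Finset.filter_eq_empty_iff.mpr fun r hr hr' =>
      (h r (by simpa using hr) hr'.1 hr'.2.1 hr'.2.2.1).not_gt hr'.2.2.2)] at hform
    omega
  have htP := D.left_mem_plane r ht
  have hrP := D.right_mem_plane t hrr
  have hcP := D.conj_mem_plane htP hrP
  have hcc : t * (t * r * t) * t = r := by
    simp [mul_assoc, ht.mul_self, ← mul_assoc t t]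
  have hcr : t * r * t ≠ r := by
    intro h
    rw [h, D.act_reflection ht, sub_eq_iff_eq_add, ← sub_eq_iff_eq_add', sub_neg_eq_add,
      ← two_smul ℝ] at hm
    refine hrt (D.eq_of_root_eq_smul hrr ht (c := 2⁻¹ * D.form (D.root t) (D.root r)) ?_)
    rw [mul_smul, ← hm, smul_smul]; norm_num
  have hct : t * r * t ≠ t := by
    intro h
    rw [mul_eq_right] at h
    exact hrt (by rw [← ht.inv]; exact (inv_eq_of_mul_eq_one_right h).symm)
  have hcm : D.act t (D.root (t * r * t)) = -D.root r := by
    rw [← neg_eq_iff_eq_neg, ← map_neg, ← hm, D.act_act, ht.mul_self]; simp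
  have hcount : inversionCount cs (D.plane t r) x + 3 ≤
      inversionCount cs (D.plane t r) (t * x) := by
    rw [D.inversionCount_mul (fun r hr => (D.mem_plane.mp hr).1) htP
      (fun r hr => D.conj_mem_plane htP hr) htx]
    have : 1 < ((D.plane t r).filter fun r => r ≠ t ∧ D.act t (D.root r) = -D.root (t * r * t) ∧
        cs.length x < cs.length (r * x) ∧ cs.length x < cs.length (t * r * t * x)).card :=
      Finset.one_lt_card.mpr ⟨r, Finset.mem_filter.mpr ⟨hrP, hrt, hm, hu, hu'⟩, t * r * t,
        Finset.mem_filter.mpr ⟨hcP, hct, by rw [hcc]; exact hcm, hu', by rw [hcc]; exact hu⟩,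
        hcr.symm⟩
    omega
  obtain ⟨r₁, h₁, r₂, h₂, h12, e₁, e₂⟩ := D.exists_two_up ht hrr hrt.symm (x := x)
    (Finset.one_lt_card.mpr ⟨r, Finset.mem_filter.mpr ⟨hrP, hu⟩, t,
      Finset.mem_filter.mpr ⟨htP, htx⟩, hrt⟩)
  obtain ⟨r₃, h₃, r₄, h₄, h34, e₃, e₄⟩ := D.exists_two_down ht hrr hrt.symm (y := t * x) (by omega)
  have refl : ∀ {s}, s ∈ D.plane t r → cs.IsReflection s := fun h => (D.mem_plane.mp h).1
  have mid : ∀ {s s'}, s ∈ D.plane t r → s' ∈ D.plane t r →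
      inversionCount cs (D.plane t r) (s * x) = inversionCount cs (D.plane t r) x + 1 →
      inversionCount cs (D.plane t r) (t * x) =
        inversionCount cs (D.plane t r) (s' * (t * x)) + 1 →
      BruhatAdj cs (s * x) (s' * (t * x)) ∧
        cs.length (s * x) < cs.length (s' * (t * x)) := by
    intro s s' hs hs' e e'
    have hP := D.mul_mul_mem_plane ht hrr hrt.symm hs' htP hs
    have hss : s' * (t * x) = s' * t * s * (s * x) := by
      simp only [mul_assoc]
      rw [← mul_assoc s s, (refl hs).mul_self, one_mul]
    rw [hss] at e' ⊢
    exact ⟨bruhatAdj_mul (refl hP) _, D.length_lt_of_inversionCount_lt hP (by omega)⟩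
  have top : ∀ {s}, s ∈ D.plane t r → inversionCount cs (D.plane t r) (t * x) =
        inversionCount cs (D.plane t r) (s * (t * x)) + 1 →
      cs.length (s * (t * x)) < cs.length (t * x) := by
    intro s hs e
    have := D.length_lt_of_inversionCount_lt hs (x := s * (t * x))
    rw [← mul_assoc s s, (refl hs).mul_self, one_mul] at this
    exact this (by omega)
  exact ⟨r₁ * x, r₂ * x, r₃ * (t * x), r₄ * (t * x), fun h => h12 (mul_right_cancel h),
    fun h => h34 (mul_right_cancel h), bruhatAdj_mul (refl h₁) _, bruhatAdj_mul (refl h₂) _,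
    (mid h₁ h₃ e₁ e₃).1, (mid h₂ h₃ e₂ e₃).1, (mid h₁ h₄ e₁ e₄).1, (mid h₂ h₄ e₂ e₄).1,
    (bruhatAdj_mul (refl h₃) _).symm, (bruhatAdj_mul (refl h₄) _).symm,
    D.length_lt_of_inversionCount_lt h₁ (by omega), D.length_lt_of_inversionCount_lt h₂ (by omega),
    (mid h₁ h₃ e₁ e₃).2, (mid h₂ h₃ e₂ e₃).2, (mid h₁ h₄ e₁ e₄).2, (mid h₂ h₄ e₂ e₄).2,
    top h₃ e₃, top h₄ e₄⟩

include D in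
theorem exists_diamond {z x y : W} (hzx : BruhatAdj cs z x) (hxy : BruhatAdj cs x y)
    (h₁ : cs.length z < cs.length x) (h₂ : cs.length x < cs.length y) :
    ∃ x', x' ≠ x ∧ BruhatAdj cs z x' ∧ BruhatAdj cs x' y ∧
      cs.length z < cs.length x' ∧ cs.length x' < cs.length y := by
  classical
  obtain ⟨t₁, ht₁, rfl⟩ := hzx.exists_eq_mul
  obtain ⟨t₂, ht₂, rfl⟩ := hxy.exists_eq_mul
  have h12 : t₁ ≠ t₂ := by
    rintro rfl
    rw [← mul_assoc, ht₁.mul_self, one_mul] at h₂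
    omega
  have hP₁ := D.left_mem_plane t₂ ht₁
  have hP₂ := D.right_mem_plane t₁ ht₂
  have c₁ := D.inversionCount_plane_mul hP₁ h₁
  have c₂ := D.inversionCount_plane_mul hP₂ h₂
  have hle : inversionCount cs (D.plane t₁ t₂) (t₂ * (t₁ * z)) ≤ (D.plane t₁ t₂).card :=
    Finset.card_filter_le _ _
  have hsplit : inversionCount cs (D.plane t₁ t₂) z +
      ((D.plane t₁ t₂).filter fun r => cs.length z < cs.length (r * z)).card =
      (D.plane t₁ t₂).card := by
    rw [← Finset.card_filter_add_card_filter_not (s := D.plane t₁ t₂)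
      (fun r => cs.length (r * z) < cs.length z), inversionCount]
    congr 2
    refine Finset.filter_congr fun r hr => ?_
    have := (D.mem_plane.mp hr).1.length_mul_right_ne z
    omega
  obtain ⟨r₁, hr₁, r₂, hr₂, hne, e₁, e₂⟩ := D.exists_two_up ht₁ ht₂ h12 (x := z) (by omega)
  have key : ∀ r ∈ D.plane t₁ t₂, r ≠ t₁ →
      inversionCount cs (D.plane t₁ t₂) (r * z) = inversionCount cs (D.plane t₁ t₂) z + 1 →
      ∃ x', x' ≠ t₁ * z ∧ BruhatAdj cs z x' ∧ BruhatAdj cs x' (t₂ * (t₁ * z)) ∧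
        cs.length z < cs.length x' ∧ cs.length x' < cs.length (t₂ * (t₁ * z)) := by
    intro r hr hrt e
    have hrr := (D.mem_plane.mp hr).1
    have hP := D.mul_mul_mem_plane ht₁ ht₂ h12 hP₂ hP₁ hr
    have hss : t₂ * (t₁ * z) = t₂ * t₁ * r * (r * z) := by
      simp only [mul_assoc]
      rw [← mul_assoc r r, hrr.mul_self, one_mul]
    refine ⟨r * z, fun h => hrt (mul_right_cancel h), bruhatAdj_mul hrr _, ?_,
      D.length_lt_of_inversionCount_lt hr (by omega), ?_⟩
    · rw [hss]; exact bruhatAdj_mul (D.mem_plane.mp hP).1 _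
    · rw [hss] at c₂ ⊢
      exact D.length_lt_of_inversionCount_lt hP (by omega)
  by_cases h : r₁ = t₁
  · exact key r₂ hr₂ (fun h' => hne (h.trans h'.symm)) e₂
  · exact key r₁ hr₁ h e₁

theorem plane_subset {a b r s : W} (hr : r ∈ D.plane a b) (hs : s ∈ D.plane a b) :
    D.plane r s ⊆ D.plane a b := by
  intro x hx
  rw [mem_plane] at *
  refine ⟨hx.1, ?_⟩
  have : Submodule.span ℝ {D.root r, D.root s} ≤ Submodule.span ℝ {D.root a, D.root b} := by
    rw [Submodule.span_le, Set.pair_subset_iff]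
    exact ⟨hr.2, hs.2⟩
  exact this hx.2

theorem left_mem_plane_of_mul_eq {t₁ t₂ t₃ t₄ : W} (h₁ : cs.IsReflection t₁)
    (h₂ : cs.IsReflection t₂) (h₃ : cs.IsReflection t₃) (h₄ : cs.IsReflection t₄)
    (h12 : t₁ ≠ t₂) (h : t₃ * t₄ = t₁ * t₂) : t₃ ∈ D.plane t₁ t₂ := by
  rw [mem_plane]
  refine ⟨h₃, ?_⟩
  have h34 : t₃ ≠ t₄ := by
    rintro rfl
    rw [h₃.mul_self] at h
    exact h12 (by rw [← h₁.inv]; exact inv_eq_of_mul_eq_one_right h.symm)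
  have hc := D.four_sub_sq_ne_zero h₃ h₄ h34
  set c := D.form (D.root t₃) (D.root t₄) with hc'
  set v := D.root t₃ - (c / 2) • D.root t₄ with hv
  have f4 : D.form (D.root t₄) v = 0 := by
    rw [hv, map_sub, map_smul, D.form_root_self h₄, D.form_symm, ← hc', smul_eq_mul]; ring
  have f3 : D.form (D.root t₃) v = (4 - c ^ 2) / 2 := by
    rw [hv, map_sub, map_smul, D.form_root_self h₃, ← hc', smul_eq_mul]; ring
  have e₁ : D.act (t₃ * t₄) v = v - ((4 - c ^ 2) / 2) • D.root t₃ := by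
    rw [← D.act_act, D.act_reflection h₄, f4, zero_smul, sub_zero, D.act_reflection h₃, f3]
  have e₂ : v - D.act (t₁ * t₂) v ∈ Submodule.span ℝ {D.root t₁, D.root t₂} := by
    rw [← D.act_act, D.act_reflection h₂, D.act_reflection h₁]
    refine Submodule.mem_span_pair.mpr ⟨D.form (D.root t₁) (v - D.form (D.root t₂) v • D.root t₂),
      D.form (D.root t₂) v, ?_⟩
    module
  rw [← h, e₁, sub_sub_cancel] at e₂
  exact (Submodule.smul_mem_iff _ (div_ne_zero hc two_ne_zero)).mp e₂

theorem mul_inv_mem_plane {p q r s : W} (hpr : p ≠ r) (hpq : BruhatAdj cs p q)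
    (hqr : BruhatAdj cs q r) (hps : BruhatAdj cs p s) (hsr : BruhatAdj cs s r) :
    s * p⁻¹ ∈ D.plane (q * p⁻¹) (r * q⁻¹) := by
  have hinv := D.left_mem_plane_of_mul_eq hpq hqr hps hsr ?_ ?_
  · exact hinv
  · intro h
    refine hpr ?_
    rw [← hpq.inv, mul_inv_rev, inv_inv] at h
    exact mul_right_cancel h
  · rw [← hps.inv_mul_eq, ← hsr.inv_mul_eq, ← hpq.inv_mul_eq, ← hqr.inv_mul_eq]
    simp [← mul_assoc]

include D in
/-- A subgraph of the Bruhat graph isomorphic to `K₃,₃` minus an edge can be completed. -/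
theorem bruhatAdj_of_hexagon {x a b c d y : W} (hab : a ≠ b) (hcd : c ≠ d)
    (hxa : BruhatAdj cs x a) (hxb : BruhatAdj cs x b) (hac : BruhatAdj cs a c)
    (hbc : BruhatAdj cs b c) (had : BruhatAdj cs a d) (hbd : BruhatAdj cs b d)
    (hcy : BruhatAdj cs c y) (hdy : BruhatAdj cs d y) : BruhatAdj cs x y := by
  have hne : a * c⁻¹ ≠ d * a⁻¹ := by
    rw [← had.inv_mul_eq]
    exact fun h => hcd (inv_injective (mul_left_cancel h))
  have m₁ := D.left_mem_plane (d * a⁻¹) hac.symm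
  have m₂ := D.mul_inv_mem_plane hcd hac.symm had hbc.symm hbd
  have m₃ := D.mul_inv_mem_plane hcd hac.symm had hcy hdy.symm
  have m₄ := D.mul_inv_mem_plane hab hac hbc.symm hxa.symm hxb
  have m₅ := D.plane_subset (by rwa [← hac.inv_mul_eq]) m₂ m₄
  have := D.mul_mul_mem_plane hac.symm had hne m₃ (by rw [← hac.inv_mul_eq] at *; exact m₁) m₅
  have := (D.mem_plane.mp this).1
  rw [← hxa.symm.inv_mul_eq, ← hac.symm.inv_mul_eq] at this
  simpa [BruhatAdj, mul_assoc] using this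

end RootData

section
variable {cs : CoxeterSystem M W}

theorem bruhatAdj_iff {x y : W} : BruhatAdj cs x y ↔ cs.IsReflection (x⁻¹ * y) := by
  rw [BruhatAdj, ← cs.isReflection_conj_iff x (x⁻¹ * y)]
  simp

theorem BruhatAdj.bruhatLE {x y : W} (h : BruhatAdj cs x y) (hl : cs.length x < cs.length y) :
    BruhatLE cs x y :=
  .single ⟨_, h, by simp, hl⟩

theorem BruhatAdj.length_ne {x y : W} (h : BruhatAdj cs x y) : cs.length x ≠ cs.length y := by
  obtain ⟨r, hr, rfl⟩ := h.exists_eq_mul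
  exact (hr.length_mul_right_ne x).symm

end

/-! ### Special matchings and the Bruhat graph -/

/-- A realization of a poset as a convex subset of the Bruhat order. -/
structure IsBruhatConvex {α : Type*} [PartialOrder α] (cs : CoxeterSystem M W) (ι : α → W) :
    Prop where
  le_iff : ∀ a b, a ≤ b ↔ BruhatLE cs (ι a) (ι b)
  convex : ∀ a b v, BruhatLE cs (ι a) v → BruhatLE cs v (ι b) → ∃ c, ι c = v

namespace IsBruhatConvex
variable {α : Type*} [PartialOrder α] {cs : CoxeterSystem M W} {ι : α → W}
  (hι : IsBruhatConvex cs ι)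
include hι

theorem injective : Function.Injective ι := fun a b h =>
  le_antisymm ((hι.le_iff a b).mpr (h ▸ .refl)) ((hι.le_iff b a).mpr (h ▸ .refl))

theorem length_lt {a b : α} (h : a < b) : cs.length (ι a) < cs.length (ι b) :=
  BruhatLE.length_lt ((hι.le_iff a b).mp h.le) fun e => h.ne (hι.injective e)

theorem lt_of_bruhatAdj {a b : α} (h : BruhatAdj cs (ι a) (ι b))
    (hl : cs.length (ι a) < cs.length (ι b)) : a < b :=
  lt_of_le_of_ne ((hι.le_iff a b).mpr (h.bruhatLE hl)) (by rintro rfl; exact hl.false)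

theorem exists_between {a b : α} {v : W} (h₁ : BruhatAdj cs (ι a) v) (h₂ : BruhatAdj cs v (ι b))
    (hl₁ : cs.length (ι a) < cs.length v) (hl₂ : cs.length v < cs.length (ι b)) :
    ∃ c, ι c = v := hι.convex a b v (h₁.bruhatLE hl₁) (h₂.bruhatLE hl₂)

variable {V : Type*} [AddCommGroup V] [Module ℝ V] (D : RootData cs V) [Finite W]

include D in
theorem covBy_iff {a b : α} :
    a ⋖ b ↔ BruhatAdj cs (ι a) (ι b) ∧ cs.length (ι b) = cs.length (ι a) + 1 := by
  constructor
  · intro h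
    have hadj : BruhatAdj cs (ι a) (ι b) ∧ cs.length (ι a) < cs.length (ι b) := by
      rcases Relation.ReflTransGen.cases_head ((hι.le_iff a b).mp h.le) with e | ⟨c, hc, hcb⟩
      · exact absurd (hι.injective e) h.ne
      · obtain ⟨c, rfl⟩ := hι.convex a b c (.single hc) hcb
        obtain ⟨t, ht, e, hl⟩ := hc
        have hac : a < c := lt_of_le_of_ne ((hι.le_iff a c).mpr (.single ⟨t, ht, e, hl⟩))
          (by rintro rfl; exact hl.false)
        have hcb' : c = b := (h.eq_or_eq hac.le ((hι.le_iff c b).mpr hcb)).resolve_left hac.ne'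
        subst hcb'
        exact ⟨by rw [e]; exact bruhatAdj_mul ht _, hl⟩
    refine ⟨hadj.1, ?_⟩
    by_contra hne
    obtain ⟨x, -, y, -, -, -, hax, -, hxy, -, -, -, hyb, -, l₁, -, l₂, -, -, -, l₃, -⟩ :=
      D.exists_intermediate hadj.1 (by omega)
    have hxb := (hxy.bruhatLE l₂).trans (hyb.bruhatLE l₃)
    obtain ⟨c, rfl⟩ := hι.convex a b x (hax.bruhatLE l₁) hxb
    have hac := hι.lt_of_bruhatAdj hax l₁
    have hcb : c < b := lt_of_le_of_ne ((hι.le_iff c b).mpr hxb) (by rintro rfl; omega)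
    exact h.2 hac hcb
  · rintro ⟨h, hl⟩
    refine ⟨hι.lt_of_bruhatAdj h (by omega), fun c hac hcb => ?_⟩
    have := hι.length_lt hac
    have := hι.length_lt hcb
    omega

include D in
theorem bruhatAdj_of_lt {a b : α} (h : a < b) (hl : cs.length (ι b) = cs.length (ι a) + 1) :
    BruhatAdj cs (ι a) (ι b) := by
  refine ((hι.covBy_iff D).mp ⟨h, fun c hac hcb => ?_⟩).1
  have := hι.length_lt hac
  have := hι.length_lt hcb
  omega

variable {f : α → α} (hf : IsSpecialMatching f)
include hf

include D in
theorem bruhatAdj_matching (a : α) : BruhatAdj cs (ι a) (ι (f a)) ∧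
    (cs.length (ι (f a)) = cs.length (ι a) + 1 ∨ cs.length (ι a) = cs.length (ι (f a)) + 1) := by
  rcases hf.1.2 a with h | h
  · obtain ⟨h₁, h₂⟩ := (hι.covBy_iff D).mp h
    exact ⟨h₁.symm, .inr h₂⟩
  · obtain ⟨h₁, h₂⟩ := (hι.covBy_iff D).mp h
    exact ⟨h₁, .inl h₂⟩

include D in
theorem bruhatAdj_matching_of_length_eq {z z' : α} (h : BruhatAdj cs (ι z) (ι z'))
    (hl : cs.length (ι z') = cs.length (ι z) + 1) : BruhatAdj cs (ι (f z)) (ι (f z')) := by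
  have hinv := hf.1.1
  rcases hf.2 z z' ((hι.covBy_iff D).mpr ⟨h, hl⟩) with e | hlt
  · rw [e, show f z' = z by rw [← e, hinv]]
    exact h.symm
  obtain ⟨hz, lz⟩ := hι.bruhatAdj_matching D hf z
  obtain ⟨hz', lz'⟩ := hι.bruhatAdj_matching D hf z'
  have hlt' := hι.length_lt hlt
  by_cases h1 : cs.length (ι (f z')) = cs.length (ι (f z)) + 1
  · exact hι.bruhatAdj_of_lt D hlt h1
  obtain ⟨v, hne, hv₁, hv₂, lv₁, lv₂⟩ := D.exists_diamond hz.symm h (by omega) (by omega)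
  obtain ⟨b, rfl⟩ := hι.exists_between hv₁ hv₂ lv₁ lv₂
  have hbz : b ≠ z := fun e => hne (congrArg ι e)
  have h₁ : z < f b := by
    have := hf.2 (f z) b ((hι.covBy_iff D).mpr ⟨hv₁, by omega⟩)
    rw [hinv] at this
    exact this.resolve_left hbz.symm
  have h₂ : f b < f z' := by
    refine (hf.2 b z' ((hι.covBy_iff D).mpr ⟨hv₂, by omega⟩)).resolve_left fun e => ?_
    have : f z' = b := by rw [← e, hinv]
    rw [this] at lz' h1 hlt'
    omega
  have hd : z' ≠ f b := fun e => by
    have : f z' = b := by rw [e, hinv]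
    rw [this] at lz' h1 hlt'
    omega
  have l₁ := hι.length_lt h₁
  have l₂ := hι.length_lt h₂
  exact D.bruhatAdj_of_hexagon (fun e => hbz (hι.injective e).symm) (fun e => hd (hι.injective e))
    hz.symm hv₁ h hv₂ (hι.bruhatAdj_of_lt D h₁ (by omega)) (hι.bruhatAdj_matching D hf b).1 hz'
    (hι.bruhatAdj_of_lt D h₂ (by omega))

include D in
theorem bruhatAdj_matching_of_length_lt {z z' : α} (h : BruhatAdj cs (ι z) (ι z'))
    (hl : cs.length (ι z) < cs.length (ι z')) : BruhatAdj cs (ι (f z)) (ι (f z')) := by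
  induction hn : cs.length (ι z') - cs.length (ι z) using Nat.strong_induction_on
    generalizing z z' with
  | _ n ih =>
  by_cases h1 : cs.length (ι z') = cs.length (ι z) + 1
  · exact hι.bruhatAdj_matching_of_length_eq D hf h h1
  obtain ⟨a, b, c, d, hab, hcd, hxa, hxb, hac, hbc, had, hbd, hcy, hdy, lxa, lxb, lac, lbc, lad,
    lbd, lcy, ldy⟩ := D.exists_intermediate h (by omega)
  obtain ⟨a, rfl⟩ := hι.convex z z' a (hxa.bruhatLE lxa)
    ((hac.bruhatLE lac).trans (hcy.bruhatLE lcy))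
  obtain ⟨b, rfl⟩ := hι.convex z z' b (hxb.bruhatLE lxb)
    ((hbc.bruhatLE lbc).trans (hcy.bruhatLE lcy))
  obtain ⟨c, rfl⟩ := hι.exists_between hac hcy lac lcy
  obtain ⟨d, rfl⟩ := hι.exists_between had hdy lad ldy
  have hinj : Function.Injective fun a => ι (f a) := hι.injective.comp hf.1.1.injective
  have hab' : ι (f a) ≠ ι (f b) := fun e => hab (congrArg ι (hinj e))
  have hcd' : ι (f c) ≠ ι (f d) := fun e => hcd (congrArg ι (hinj e))
  exact D.bruhatAdj_of_hexagon hab' hcd' (ih _ (by omega) hxa lxa rfl) (ih _ (by omega) hxb lxb rfl)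
    (ih _ (by omega) hac lac rfl) (ih _ (by omega) hbc lbc rfl) (ih _ (by omega) had lad rfl)
    (ih _ (by omega) hbd lbd rfl) (ih _ (by omega) hcy lcy rfl) (ih _ (by omega) hdy ldy rfl)

include D in
/-- A special matching is an automorphism of the Bruhat graph. -/
theorem bruhatAdj_map {z z' : α} (h : BruhatAdj cs (ι z) (ι z')) :
    BruhatAdj cs (ι (f z)) (ι (f z')) := by
  rcases lt_or_gt_of_ne h.length_ne with hl | hl
  · exact hι.bruhatAdj_matching_of_length_lt D hf h hl
  · exact (hι.bruhatAdj_matching_of_length_lt D hf h.symm hl).symm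

include D in
theorem ncard_bruhatAdj_top {t : α} (ht : ∀ a, a ≤ t) :
    {b | BruhatAdj cs (ι t) (ι b)}.ncard =
      {b | b ≤ f t ∧ BruhatAdj cs (ι (f t)) (ι b)}.ncard + 1 := by
  have hinv := hf.1.1
  have : Finite α := Finite.of_injective ι hι.injective
  have hcov : f t ⋖ t := (hf.1.2 t).resolve_right fun h => (ht (f t)).not_gt h.lt
  obtain ⟨hadj, hlen⟩ := (hι.covBy_iff D).mp hcov
  have heq : {b | BruhatAdj cs (ι t) (ι b)} =
      insert (f t) (f '' {b | b ≤ f t ∧ BruhatAdj cs (ι (f t)) (ι b)}) := by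
    ext y
    simp only [Set.mem_insert_iff, Set.mem_image]
    constructor
    · intro (h : BruhatAdj cs (ι t) (ι y))
      by_cases hy : y = f t
      · exact .inl hy
      have h' := hι.bruhatAdj_map D hf h
      refine .inr ⟨f y, ⟨?_, h'⟩, hinv y⟩
      rcases lt_or_gt_of_ne h'.length_ne with hl | hl
      · have hne : f y ≠ t := fun e => hy (by rw [← e, hinv])
        have := hι.length_lt (lt_of_le_of_ne (ht (f y)) hne)
        omega
      · exact (hι.lt_of_bruhatAdj h'.symm hl).le
    · rintro (rfl | ⟨b, ⟨-, h⟩, rfl⟩)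
      · exact hadj.symm
      · have := hι.bruhatAdj_map D hf h
        rwa [hinv] at this
  rw [heq, Set.ncard_insert_of_notMem, Set.ncard_image_of_injective _ hinv.injective]
  rintro ⟨b, ⟨hb, -⟩, e⟩
  rw [hinv.injective e] at hb
  exact hb.not_gt hcov.lt

end IsBruhatConvex

theorem RootData.bruhatDeg_self_eq {cs : CoxeterSystem M W} [Finite W]
    {V : Type*} [AddCommGroup V] [Module ℝ V] (D : RootData cs V) {u w : W}
    (hz : IsZircon (BruhatInterval cs u w)) {x : W} (hux : BruhatLE cs u x)
    (hxw : BruhatLE cs x w) : bruhatDeg cs u x x = cs.length x - cs.length u := by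
  have huniv : ∀ x : W, bruhatDeg cs u x x =
      {y : W | (BruhatLE cs u y ∧ BruhatLE cs y x) ∧ BruhatAdj cs x y}.ncard := fun x => by
    simp only [bruhatAdj_iff]; rfl
  induction hn : cs.length x using Nat.strong_induction_on generalizing x with
  | _ n ih =>
  by_cases hne : u = x
  · subst hne
    rw [← hn, Nat.sub_self, huniv, Set.ncard_eq_zero]
    ext y
    simp only [Set.mem_empty_iff_false, iff_false]
    rintro ⟨⟨h₁, h₂⟩, h⟩
    exact h.length_ne (by rw [h₁.antisymm h₂])
  set X : BruhatInterval cs u w := ⟨x, hux, hxw⟩ with hX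
  set U : BruhatInterval cs u w := ⟨u, .refl, hux.trans hxw⟩ with hU
  have hUX : U < X := lt_of_le_of_ne hux fun e => hne (congrArg Subtype.val e)
  obtain ⟨-, f, hf⟩ := hz X ⟨U, hUX⟩
  set ι : {v : BruhatInterval cs u w // v ≤ X} → W := fun a => a.1.1 with hι'
  have hι : IsBruhatConvex cs ι :=
    ⟨fun a b => Iff.rfl, fun a b v h₁ h₂ =>
      ⟨⟨⟨v, a.1.2.1.trans h₁, h₂.trans b.1.2.2⟩, h₂.trans b.2⟩, rfl⟩⟩
  have key := hι.ncard_bruhatAdj_top D hf (t := ⟨X, le_rfl⟩) fun a => a.2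
  set v := f ⟨X, le_rfl⟩ with hv
  have hcov : v ⋖ ⟨X, le_rfl⟩ := (hf.1.2 ⟨X, le_rfl⟩).resolve_right fun h => v.2.not_gt h.lt
  have hlen : cs.length x = cs.length (ι v) + 1 := ((hι.covBy_iff D).mp hcov).2
  have ih' := ih (cs.length (ι v)) (by omega) v.1.2.1 v.1.2.2 rfl
  have e₁ : {y : W | (BruhatLE cs u y ∧ BruhatLE cs y x) ∧ BruhatAdj cs x y} =
      ι '' {b | BruhatAdj cs (ι ⟨X, le_rfl⟩) (ι b)} := by
    ext y
    constructor
    · rintro ⟨⟨h₁, h₂⟩, h⟩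
      exact ⟨⟨⟨y, h₁, h₂.trans hxw⟩, h₂⟩, h, rfl⟩
    · rintro ⟨b, h, rfl⟩
      exact ⟨⟨b.1.2.1, b.2⟩, h⟩
  have e₂ : {y : W | (BruhatLE cs u y ∧ BruhatLE cs y (ι v)) ∧ BruhatAdj cs (ι v) y} =
      ι '' {b | b ≤ v ∧ BruhatAdj cs (ι v) (ι b)} := by
    ext y
    constructor
    · rintro ⟨⟨h₁, h₂⟩, h⟩
      exact ⟨⟨⟨y, h₁, h₂.trans v.1.2.2⟩, h₂.trans v.2⟩, ⟨h₂, h⟩, rfl⟩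
    · rintro ⟨b, ⟨hb, h⟩, rfl⟩
      exact ⟨⟨b.1.2.1, hb⟩, h⟩
  rw [huniv, e₂, Set.ncard_image_of_injective _ hι.injective] at ih'
  rw [huniv, e₁, Set.ncard_image_of_injective _ hι.injective, key, ih', ← hn, hlen]
  have : cs.length u ≤ cs.length (ι v) := v.1.2.1.length_le
  omega

/-! ### Reflections of a bilinear form -/

section
variable {V : Type*} [AddCommGroup V] [Module ℝ V] (F : V →ₗ[ℝ] V →ₗ[ℝ] ℝ)

/-- The reflection in a vector `x` of norm two. -/
def formReflection (x : V) : Module.End ℝ V := LinearMap.id - (F x).smulRight x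

theorem formReflection_apply (x v : V) : formReflection F x v = v - F x v • x := rfl

variable {F} {x y : V} {c : ℝ}

theorem formReflection_mul_self (hx : F x x = 2) :
    formReflection F x * formReflection F x = 1 := by
  ext v
  simp only [Module.End.mul_apply, Module.End.one_apply, formReflection_apply, map_sub, map_smul,
    hx]
  module

theorem formReflection_mul_sq (hx : F x x = 2) (hy : F y y = 2) (hxy : F x y = 0)
    (hyx : F y x = 0) : (formReflection F x * formReflection F y) ^ 2 = 1 := by
  ext v
  simp only [pow_two, Module.End.mul_apply, Module.End.one_apply, formReflection_apply, map_sub,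
    map_smul, hx, hy, hxy, hyx]
  module

theorem formReflection_mul_cube (hx : F x x = 2) (hy : F y y = 2) (hxy : F x y = c)
    (hyx : F y x = c) : (formReflection F x * formReflection F y) ^ 3 =
      (c ^ 2 - 1) • (formReflection F x * formReflection F y) ^ 2 -
      (c ^ 2 - 1) • (formReflection F x * formReflection F y) + 1 := by
  ext v
  simp only [pow_succ, pow_zero, one_mul, Module.End.mul_apply, Module.End.one_apply,
    formReflection_apply, map_sub, LinearMap.add_apply, LinearMap.sub_apply, LinearMap.smul_apply,
    map_smul, hx, hy, hxy, hyx]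
  module

theorem formReflection_mul_pow_four (hx : F x x = 2) (hy : F y y = 2) (hxy : F x y = c)
    (hyx : F y x = c) (hc : c ^ 2 = 2) : (formReflection F x * formReflection F y) ^ 4 = 1 := by
  have h := formReflection_mul_cube hx hy hxy hyx
  set u := formReflection F x * formReflection F y
  rw [hc, show (2 - 1 : ℝ) = 1 by norm_num, one_smul, one_smul] at h
  have h4 : u ^ 4 = u ^ 3 - u ^ 2 + u := by
    rw [pow_succ u 3]; nth_rewrite 1 [h]; noncomm_ring
  rw [h4, h]; abel

theorem formReflection_mul_pow_six (hx : F x x = 2) (hy : F y y = 2) (hxy : F x y = c)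
    (hyx : F y x = c) (hc : c ^ 2 = 3) : (formReflection F x * formReflection F y) ^ 6 = 1 := by
  have h := formReflection_mul_cube hx hy hxy hyx
  set u := formReflection F x * formReflection F y
  have h' : u ^ 3 = u ^ 2 + u ^ 2 - u - u + 1 := by
    rw [h, hc]; module
  have h4 : u ^ 4 = u ^ 3 + u ^ 3 - u ^ 2 - u ^ 2 + u := by
    rw [pow_succ u 3]; nth_rewrite 1 [h']; noncomm_ring
  have h5 : u ^ 5 = u ^ 4 + u ^ 4 - u ^ 3 - u ^ 3 + u ^ 2 := by
    rw [pow_succ u 4]; nth_rewrite 1 [h4]; noncomm_ring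
  have h6 : u ^ 6 = u ^ 5 + u ^ 5 - u ^ 4 - u ^ 4 + u ^ 3 := by
    rw [pow_succ u 5]; nth_rewrite 1 [h5]; noncomm_ring
  rw [h6, h5, h4, h']; abel

theorem eq_or_eq_neg_of_formReflection_eq (hx : F x x = 2) (hy : F y y = 2)
    (h : formReflection F x = formReflection F y) : x = y ∨ x = -y := by
  have h1 := LinearMap.congr_fun h x
  rw [formReflection_apply, formReflection_apply, hx] at h1
  have h2 : x = (F y x / 2) • y := by
    rw [div_eq_inv_mul, mul_smul, eq_inv_smul_iff₀ two_ne_zero]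
    exact sub_right_injective h1
  have h3 : (F y x / 2) * (F y x / 2) = 1 := by
    have h4 := hx
    rw [h2] at h4
    simp only [map_smul, LinearMap.smul_apply, smul_eq_mul, hy] at h4
    linarith
  rcases mul_self_eq_one_iff.mp h3 with h4 | h4 <;> rw [h4] at h2
  · exact .inl (by rwa [one_smul] at h2)
  · exact .inr (by rwa [neg_one_smul] at h2)

theorem formReflection_smul (h : c * c = 1) : formReflection F (c • x) = formReflection F x := by
  ext v
  rw [formReflection_apply, formReflection_apply, map_smul, LinearMap.smul_apply, smul_eq_mul,
    smul_smul, mul_right_comm, h, one_mul]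

end

/-! ### The geometric representation -/

/-- The canonical bilinear form of a Coxeter matrix, normalized so that simple roots have
norm two. -/
noncomputable def geomForm (M : CoxeterMatrix B) : (B →₀ ℝ) →ₗ[ℝ] (B →₀ ℝ) →ₗ[ℝ] ℝ :=
  Finsupp.linearCombination ℝ fun i =>
    Finsupp.linearCombination ℝ fun j => -2 * Real.cos (Real.pi / M i j)

/-- The simple roots. -/
noncomputable def simpleRoot (i : B) : B →₀ ℝ := Finsupp.single i 1

theorem geomForm_simpleRoot (i j : B) :
    geomForm M (simpleRoot i) (simpleRoot j) = -2 * Real.cos (Real.pi / M i j) := by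
  simp [geomForm, simpleRoot]

theorem geomForm_simpleRoot_self (i : B) : geomForm M (simpleRoot i) (simpleRoot i) = 2 := by
  simp [geomForm_simpleRoot]

theorem geomForm_symm (v v' : B →₀ ℝ) : geomForm M v v' = geomForm M v' v := by
  have : geomForm M = (geomForm M).flip := by
    ext i j
    simp [geomForm, M.symmetric i j]
  exact LinearMap.congr_fun (LinearMap.congr_fun this v) v'

theorem isLiftable_formReflection
    (hcrys : ∀ i j : B, i ≠ j → M i j ∈ ({2, 3, 4, 6} : Set ℕ)) :
    M.IsLiftable fun i => formReflection (geomForm M) (simpleRoot i) := by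
  intro i j
  have hi := geomForm_simpleRoot_self (M := M) i
  have hj := geomForm_simpleRoot_self (M := M) j
  have hij := geomForm_simpleRoot (M := M) i j
  have hji := geomForm_symm (M := M) (simpleRoot j) (simpleRoot i)
  rw [hij] at hji
  by_cases h : i = j
  · subst h
    rw [M.diagonal, pow_one, formReflection_mul_self hi]
  · rcases hcrys i j h with h | h | h | h <;> rw [h] at hij hji ⊢ <;> push_cast at hij hji
    · rw [Real.cos_pi_div_two, mul_zero] at hij hji
      exact formReflection_mul_sq hi hj hij hji
    · rw [formReflection_mul_cube hi hj hij hji, Real.cos_pi_div_three]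
      norm_num
    · exact formReflection_mul_pow_four hi hj hij hji (by
        rw [Real.cos_pi_div_four, mul_pow, div_pow, Real.sq_sqrt] <;> norm_num)
    · exact formReflection_mul_pow_six hi hj hij hji (by
        rw [mul_pow, Real.sq_cos_pi_div_six]; norm_num)

/-- The geometric representation of a crystallographic Coxeter group. -/
noncomputable def geomRep (cs : CoxeterSystem M W)
    (hcrys : ∀ i j : B, i ≠ j → M i j ∈ ({2, 3, 4, 6} : Set ℕ)) : W →* Module.End ℝ (B →₀ ℝ) :=
  cs.lift ⟨_, isLiftable_formReflection hcrys⟩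

section
variable (cs : CoxeterSystem M W) (hcrys : ∀ i j : B, i ≠ j → M i j ∈ ({2, 3, 4, 6} : Set ℕ))

theorem geomRep_simple (i : B) :
    geomRep cs hcrys (cs.simple i) = formReflection (geomForm M) (simpleRoot i) :=
  cs.lift_apply_simple _ i

theorem geomRep_mul_apply (g h : W) (v : B →₀ ℝ) :
    geomRep cs hcrys (g * h) v = geomRep cs hcrys g (geomRep cs hcrys h v) := by
  rw [map_mul]; rfl

theorem geomRep_simple_simpleRoot (i : B) :
    geomRep cs hcrys (cs.simple i) (simpleRoot i) = -simpleRoot i := by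
  rw [geomRep_simple, formReflection_apply, geomForm_simpleRoot_self]
  module

theorem geomForm_geomRep (g : W) (v v' : B →₀ ℝ) :
    geomForm M (geomRep cs hcrys g v) (geomRep cs hcrys g v') = geomForm M v v' := by
  induction g using cs.simple_induction_left generalizing v v' with
  | one => simp
  | mul_simple_left g i ih =>
    have key : ∀ v v' : B →₀ ℝ, geomForm M (formReflection (geomForm M) (simpleRoot i) v)
        (formReflection (geomForm M) (simpleRoot i) v') = geomForm M v v' := fun v v' => by
      simp only [formReflection_apply, map_sub, map_smul, LinearMap.sub_apply,
        LinearMap.smul_apply, geomForm_simpleRoot_self, smul_eq_mul,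
        geomForm_symm (M := M) v (simpleRoot i)]
      ring
    rw [geomRep_mul_apply, geomRep_mul_apply, geomRep_simple, key, ih]

theorem geomRep_formReflection (g : W) (x : B →₀ ℝ) {t : W}
    (h : geomRep cs hcrys t = formReflection (geomForm M) x) :
    geomRep cs hcrys (g * t * g⁻¹) = formReflection (geomForm M) (geomRep cs hcrys g x) := by
  refine LinearMap.ext fun v => ?_
  obtain ⟨v, rfl⟩ : ∃ v', v = geomRep cs hcrys g v' :=
    ⟨geomRep cs hcrys g⁻¹ v, by rw [← geomRep_mul_apply]; simp⟩
  rw [← geomRep_mul_apply, inv_mul_cancel_right, geomRep_mul_apply, h, formReflection_apply,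
    formReflection_apply, geomForm_geomRep, map_sub, map_smul]

/-! ### Positivity of roots -/

theorem geomForm_simpleRoot_nonpos {i j : B} (h : i ≠ j)
    (hcrys : ∀ i j : B, i ≠ j → M i j ∈ ({2, 3, 4, 6} : Set ℕ)) :
    geomForm M (simpleRoot i) (simpleRoot j) ≤ 0 := by
  have : 0 ≤ Real.cos (Real.pi / M i j) := by
    have hp := Real.pi_pos
    apply Real.cos_nonneg_of_neg_pi_div_two_le_of_le
    · exact le_trans (by linarith) (div_nonneg hp.le (Nat.cast_nonneg _))
    · apply div_le_div_of_nonneg_left hp.le two_pos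
      rcases hcrys i j h with h | h | h | h <;> rw [h] <;> norm_num
  rw [geomForm_simpleRoot]
  linarith

theorem geomRep_alternatingWord_simpleRoot {i j : B} (hij : i ≠ j) {k : ℕ} (hk : k < M i j) :
    ∃ p q : ℝ, 0 ≤ p ∧ 0 ≤ q ∧
      geomRep cs hcrys (cs.wordProd (CoxeterSystem.alternatingWord i j k)) (simpleRoot i) =
        p • simpleRoot i + q • simpleRoot j := by
  have hi := geomForm_simpleRoot_self (M := M) i
  have hj := geomForm_simpleRoot_self (M := M) j
  have hc := geomForm_simpleRoot_nonpos hij hcrys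
  have hij' := geomForm_simpleRoot (M := M) i j
  have hji := geomForm_symm (M := M) (simpleRoot j) (simpleRoot i)
  set c := geomForm M (simpleRoot i) (simpleRoot j) with hc'
  obtain ⟨P, hP⟩ : ∃ P : ℕ → ℝ → ℝ → Prop, ∀ n p q, P n p q ↔
      geomRep cs hcrys (cs.wordProd (CoxeterSystem.alternatingWord i j n)) (simpleRoot i) =
        p • simpleRoot i + q • simpleRoot j := ⟨_, fun _ _ _ => Iff.rfl⟩
  simp only [← hP]
  have step_even {n : ℕ} {p q : ℝ} (hn : Even n) (h : P n p q) : P (n + 1) p (-q - c * p) := by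
    rw [hP] at h ⊢
    rw [CoxeterSystem.alternatingWord_succ', if_pos hn, cs.wordProd_cons, geomRep_mul_apply, h,
      geomRep_simple, formReflection_apply, map_add, map_smul, map_smul, hji, hj]
    module
  have step_odd {n : ℕ} {p q : ℝ} (hn : ¬Even n) (h : P n p q) : P (n + 1) (-p - c * q) q := by
    rw [hP] at h ⊢
    rw [CoxeterSystem.alternatingWord_succ', if_neg hn, cs.wordProd_cons, geomRep_mul_apply, h,
      geomRep_simple, formReflection_apply, map_add, map_smul, map_smul, ← hc', hi]
    module
  have h0 : P 0 1 0 := by simp [hP, CoxeterSystem.alternatingWord]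
  have h1 : P 1 1 (-c) := by convert step_even (by decide) h0 using 1; ring
  have h2 : P 2 (c ^ 2 - 1) (-c) := by convert step_odd (by decide) h1 using 1; ring
  have h3 : P 3 (c ^ 2 - 1) (-c * (c ^ 2 - 2)) := by
    convert step_even (by decide) h2 using 1; ring
  have cases : (M i j = 2) ∨ (M i j = 3 ∧ c ^ 2 = 1) ∨ (M i j = 4 ∧ c ^ 2 = 2) ∨
      (M i j = 6 ∧ c ^ 2 = 3) := by
    rcases hcrys i j hij with h | h | h | h <;> rw [h] at hij' ⊢ <;> push_cast at hij'
    · simp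
    · rw [hij', Real.cos_pi_div_three]; norm_num
    · rw [hij', Real.cos_pi_div_four, mul_pow, div_pow, Real.sq_sqrt] <;> norm_num
    · rw [hij', mul_pow, Real.sq_cos_pi_div_six]; norm_num
  have hc0 : 0 ≤ -c := neg_nonneg.mpr hc
  rcases cases with h | ⟨h, hc2⟩ | ⟨h, hc2⟩ | ⟨h, hc2⟩ <;> rw [h] at hk
  · interval_cases k
    exacts [⟨_, _, zero_le_one, le_rfl, h0⟩, ⟨_, _, zero_le_one, hc0, h1⟩]
  · rw [hc2] at h2
    interval_cases k
    exacts [⟨_, _, zero_le_one, le_rfl, h0⟩, ⟨_, _, zero_le_one, hc0, h1⟩,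
      ⟨_, _, by norm_num, hc0, h2⟩]
  · rw [hc2] at h2 h3
    interval_cases k
    exacts [⟨_, _, zero_le_one, le_rfl, h0⟩, ⟨_, _, zero_le_one, hc0, h1⟩,
      ⟨_, _, by norm_num, hc0, h2⟩, ⟨_, _, by norm_num, by norm_num, h3⟩]
  · rw [hc2] at h2 h3
    have h4 : P 4 1 (-c) := by
      convert step_odd (by decide) h3 using 1
      · linear_combination -hc2
      · ring
    have h5 : P 5 1 0 := by convert step_even (by decide) h4 using 1; ring
    interval_cases k
    exacts [⟨_, _, zero_le_one, le_rfl, h0⟩, ⟨_, _, zero_le_one, hc0, h1⟩,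
      ⟨_, _, by norm_num, hc0, h2⟩, ⟨_, _, by norm_num, by linarith, h3⟩,
      ⟨_, _, zero_le_one, hc0, h4⟩, ⟨_, _, zero_le_one, le_rfl, h5⟩]

/-- An element `w` going up under the simple reflection `i` and down under `j` factors as an element
going up under both times an alternating word in `i` and `j`. -/
theorem exists_eq_mul_alternatingWord {w : W} {i j : B} (hij : M i j ≠ 0)
    (hi : cs.length w < cs.length (w * cs.simple i))
    (hj : cs.length (w * cs.simple j) < cs.length w) :
    ∃ v k, k < M i j ∧ w = v * cs.wordProd (CoxeterSystem.alternatingWord i j k) ∧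
      cs.length v < cs.length w ∧ cs.length v < cs.length (v * cs.simple i) ∧
      cs.length v < cs.length (v * cs.simple j) := by
  classical
  let P : ℕ → Prop := fun k => ∃ v,
    w = v * cs.wordProd (CoxeterSystem.alternatingWord i j k) ∧ cs.length v + k = cs.length w
  have hP1 : P 1 := ⟨w * cs.simple j, by simp [CoxeterSystem.alternatingWord],
    (cs.isRightDescent_iff).mp hj⟩
  have hex : ∃ k, ¬P k := ⟨cs.length w + 1, fun ⟨v, _, hv⟩ => by omega⟩
  obtain ⟨K, hK⟩ : ∃ K, Nat.find hex = K + 2 := by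
    refine ⟨Nat.find hex - 2, ?_⟩
    have h0 : Nat.find hex ≠ 0 := fun h => (h ▸ Nat.find_spec hex) ⟨w, by
      simp [CoxeterSystem.alternatingWord], rfl⟩
    have h1 : Nat.find hex ≠ 1 := fun h => (h ▸ Nat.find_spec hex) hP1
    omega
  have hmax : ¬P (K + 2) := hK ▸ Nat.find_spec hex
  have hP : ∀ k < K + 2, P k := fun k hk => not_not.mp (Nat.find_min hex (hK ▸ hk))
  obtain ⟨v, hw, hl⟩ := hP (K + 1) (by omega)
  have up_next : cs.length v < cs.length (v * cs.simple (if Even (K + 1) then j else i)) := by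
    by_contra h
    refine hmax ⟨v * cs.simple (if Even (K + 1) then j else i), ?_, ?_⟩
    · rw [CoxeterSystem.alternatingWord_succ', cs.wordProd_cons, ← mul_assoc,
        cs.simple_mul_simple_cancel_right, ← hw]
    · have := cs.length_mul_simple v (if Even (K + 1) then j else i)
      omega
  have up_first : cs.length v < cs.length (v * cs.simple (if Even K then j else i)) := by
    rw [CoxeterSystem.alternatingWord_succ', cs.wordProd_cons, ← mul_assoc] at hw
    have h1 := cs.length_mul_le (v * cs.simple (if Even K then j else i))
      (cs.wordProd (CoxeterSystem.alternatingWord i j K))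
    have h2 := cs.length_wordProd_le (CoxeterSystem.alternatingWord i j K)
    rw [CoxeterSystem.length_alternatingWord] at h2
    rw [← hw] at h1
    omega
  refine ⟨v, K + 1, ?_, hw, by omega, ?_⟩
  · by_contra hm
    obtain ⟨v, hw, hl⟩ := hP (M i j) (by omega)
    obtain ⟨m, hm⟩ := Nat.exists_eq_succ_of_ne_zero hij
    have hb := cs.wordProd_braidWord_eq i j
    rw [CoxeterSystem.braidWord, CoxeterSystem.braidWord, M.symmetric j i, hm,
      CoxeterSystem.alternatingWord_succ j i, cs.wordProd_concat] at hb
    rw [hm, hb, ← mul_assoc] at hw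
    have h1 := cs.length_mul_le v (cs.wordProd (CoxeterSystem.alternatingWord i j m))
    have h2 := cs.length_wordProd_le (CoxeterSystem.alternatingWord i j m)
    rw [CoxeterSystem.length_alternatingWord] at h2
    rw [hw, cs.simple_mul_simple_cancel_right, ← hw] at hi
    omega
  · by_cases h : Even K
    · rw [if_pos h] at up_first
      rw [if_neg fun h' => Nat.even_add_one.mp h' h] at up_next
      exact ⟨up_next, up_first⟩
    · rw [if_neg h] at up_first
      rw [if_pos (Nat.even_add_one.mpr h)] at up_next
      exact ⟨up_first, up_next⟩

theorem geomRep_simpleRoot_nonneg {w : W} {i : B}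
    (h : cs.length w < cs.length (w * cs.simple i)) :
    0 ≤ geomRep cs hcrys w (simpleRoot i) := by
  induction hn : cs.length w using Nat.strong_induction_on generalizing w i with
  | _ n ih =>
  subst hn
  by_cases hw : w = 1
  · rw [hw, map_one, Module.End.one_apply]
    exact Finsupp.single_nonneg.mpr zero_le_one
  · obtain ⟨j, hj⟩ := cs.exists_rightDescent_of_ne_one hw
    have hij : i ≠ j := by
      rintro rfl
      exact lt_asymm h hj
    have hM : M i j ≠ 0 := by
      rcases hcrys i j hij with h | h | h | h <;> rw [h] <;> norm_num
    obtain ⟨v, k, hk, hw, hv, hvi, hvj⟩ := exists_eq_mul_alternatingWord cs hM h hj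
    obtain ⟨p, q, hp, hq, e⟩ := geomRep_alternatingWord_simpleRoot cs hcrys hij hk
    rw [hw, geomRep_mul_apply, e, map_add, map_smul, map_smul]
    exact add_nonneg (smul_nonneg hp (ih _ hv hvi rfl)) (smul_nonneg hq (ih _ hv hvj rfl))

theorem geomRep_simpleRoot_nonpos {w : W} {i : B}
    (h : cs.length (w * cs.simple i) < cs.length w) :
    geomRep cs hcrys w (simpleRoot i) ≤ 0 := by
  have h1 := geomRep_simpleRoot_nonneg cs hcrys (w := w * cs.simple i) (i := i) (by simpa using h)
  rwa [geomRep_mul_apply, geomRep_simple_simpleRoot, map_neg, neg_nonneg] at h1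

theorem geomRep_injective : Function.Injective (geomRep cs hcrys) := by
  refine (injective_iff_map_eq_one _).mpr fun w hw => ?_
  by_contra h
  obtain ⟨i, hi⟩ := cs.exists_rightDescent_of_ne_one h
  have h1 := geomRep_simpleRoot_nonpos cs hcrys hi i
  rw [hw] at h1
  simp [simpleRoot] at h1
  linarith

/-! ### Positive roots -/

theorem exists_root_of_isReflection {t : W} (ht : cs.IsReflection t) :
    ∃ x : B →₀ ℝ, 0 ≤ x ∧ geomForm M x x = 2 ∧
      geomRep cs hcrys t = formReflection (geomForm M) x := by
  obtain ⟨g, i, rfl⟩ := ht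
  have key := geomRep_formReflection cs hcrys g _ (geomRep_simple cs hcrys i)
  have norm : geomForm M (geomRep cs hcrys g (simpleRoot i)) (geomRep cs hcrys g (simpleRoot i))
    = 2 := by rw [geomForm_geomRep, geomForm_simpleRoot_self]
  rcases lt_or_gt_of_ne (cs.length_mul_simple_ne g i) with h | h
  · refine ⟨-geomRep cs hcrys g (simpleRoot i),
      neg_nonneg.mpr (geomRep_simpleRoot_nonpos cs hcrys h), by simpa using norm, ?_⟩
    rw [key, ← neg_one_smul ℝ (geomRep cs hcrys g (simpleRoot i)),
      formReflection_smul (by norm_num)]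
  · exact ⟨_, geomRep_simpleRoot_nonneg cs hcrys h, norm, key⟩

open Classical in
/-- The positive root of a reflection (and zero for other elements). -/
noncomputable def posRoot (t : W) : B →₀ ℝ :=
  if ht : cs.IsReflection t then (exists_root_of_isReflection cs hcrys ht).choose else 0

variable {cs} {t : W} (ht : cs.IsReflection t)
include ht

theorem posRoot_spec : 0 ≤ posRoot cs hcrys t ∧
    geomForm M (posRoot cs hcrys t) (posRoot cs hcrys t) = 2 ∧
      geomRep cs hcrys t = formReflection (geomForm M) (posRoot cs hcrys t) := by
  rw [posRoot, dif_pos ht]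
  exact (exists_root_of_isReflection cs hcrys ht).choose_spec

theorem eq_of_posRoot_eq_smul {r : W} (hr : cs.IsReflection r) {c : ℝ}
    (h : posRoot cs hcrys t = c • posRoot cs hcrys r) : t = r := by
  obtain ⟨-, ht2, ht⟩ := posRoot_spec hcrys ht
  obtain ⟨-, hr2, hr⟩ := posRoot_spec hcrys hr
  refine geomRep_injective cs hcrys ?_
  rw [h, map_smul, map_smul, LinearMap.smul_apply, smul_eq_mul, smul_eq_mul, hr2] at ht2
  rw [ht, hr, h, formReflection_smul (by linarith)]

theorem geomRep_posRoot_eq_or (g : W) :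
    geomRep cs hcrys g (posRoot cs hcrys t) = posRoot cs hcrys (g * t * g⁻¹) ∨
    geomRep cs hcrys g (posRoot cs hcrys t) = -posRoot cs hcrys (g * t * g⁻¹) := by
  obtain ⟨-, h2, h⟩ := posRoot_spec hcrys ht
  obtain ⟨-, h2', h'⟩ := posRoot_spec hcrys (ht.conj g)
  refine eq_or_eq_neg_of_formReflection_eq ?_ h2' ?_
  · rw [geomForm_geomRep, h2]
  · rw [← h', geomRep_formReflection cs hcrys g _ h]

omit ht in
theorem posRoot_simple (i : B) : posRoot cs hcrys (cs.simple i) = simpleRoot i := by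
  obtain ⟨h0, h2, h⟩ := posRoot_spec hcrys (cs.isReflection_simple i)
  refine (eq_or_eq_neg_of_formReflection_eq h2 (geomForm_simpleRoot_self i)
    (h.symm.trans (geomRep_simple cs hcrys i))).resolve_right fun h' => ?_
  have := h0 i
  rw [h'] at this
  norm_num [simpleRoot] at this

theorem geomRep_simple_posRoot {i : B} (hne : t ≠ cs.simple i) :
    geomRep cs hcrys (cs.simple i) (posRoot cs hcrys t) =
      posRoot cs hcrys (cs.simple i * t * (cs.simple i)⁻¹) := by
  refine (geomRep_posRoot_eq_or hcrys ht _).resolve_right fun h => hne ?_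
  refine eq_of_posRoot_eq_smul hcrys ht (cs.isReflection_simple i) (c := posRoot cs hcrys t i) ?_
  rw [posRoot_simple]
  ext j
  by_cases hj : j = i
  · subst hj
    simp [simpleRoot]
  · have h1 := DFunLike.congr_fun h j
    have h2 := (posRoot_spec hcrys ht).1 j
    have h3 := (posRoot_spec hcrys (ht.conj (cs.simple i))).1 j
    simp only [geomRep_simple, formReflection_apply, simpleRoot, Finsupp.coe_sub, Finsupp.coe_smul,
      Pi.sub_apply, Pi.smul_apply, Finsupp.single_eq_of_ne hj, Finsupp.coe_neg,
      Pi.neg_apply, smul_zero, sub_zero, Finsupp.coe_zero, Pi.zero_apply] at h1 h2 h3 ⊢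
    linarith

theorem geomRep_posRoot_of_lt {g : W} (h : cs.length g < cs.length (g * t)) :
    geomRep cs hcrys g (posRoot cs hcrys t) = posRoot cs hcrys (g * t * g⁻¹) := by
  induction hn : cs.length g generalizing g with
  | zero =>
    rw [cs.length_eq_zero_iff.mp hn]
    simp
  | succ n ih =>
    obtain ⟨i, hi⟩ := cs.exists_leftDescent_of_ne_one (w := g) fun h => by simp [h] at hn
    obtain ⟨g, rfl⟩ : ∃ g', g = cs.simple i * g' := ⟨cs.simple i * g, by simp⟩
    have hg : cs.length g = n := by
      have := cs.isLeftDescent_iff.mp hi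
      rw [cs.simple_mul_simple_cancel_left] at this
      omega
    rw [mul_assoc] at h
    have h1 := cs.length_simple_mul (g * t) i
    have hne := ht.length_mul_left_ne g
    rw [geomRep_mul_apply, ih (by omega) hg, geomRep_simple_posRoot hcrys (ht.conj g)]
    · congr 1
      group
    · intro h'
      have : cs.simple i * g = g * t := by rw [← h']; group
      have h2 : cs.simple i * (g * t) = g := by rw [← this]; simp
      rw [h2] at h
      omega

theorem geomRep_posRoot_of_gt {g : W} (h : cs.length (g * t) < cs.length g) :
    geomRep cs hcrys g (posRoot cs hcrys t) = -posRoot cs hcrys (g * t * g⁻¹) := by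
  obtain ⟨-, h2, h'⟩ := posRoot_spec hcrys ht
  have h1 := geomRep_posRoot_of_lt hcrys ht (g := g * t) (by rwa [mul_assoc, ht.mul_self, mul_one])
  have h3 : g * t * t * (g * t)⁻¹ = g * t * g⁻¹ := by
    rw [mul_assoc g, ht.mul_self, mul_one, mul_inv_rev, ht.inv, mul_assoc]
  rw [h3, geomRep_mul_apply, h', formReflection_apply, h2] at h1
  rw [← h1, ← map_neg]
  congr 1
  module

omit ht in
variable (cs) in
/-- The root data of a crystallographic Coxeter group. -/
noncomputable def geomRootData : RootData cs (B →₀ ℝ) where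
  act := geomRep cs hcrys
  root := posRoot cs hcrys
  form := geomForm M
  height := Finsupp.linearCombination ℝ fun _ => 1
  form_symm := geomForm_symm
  form_root_self ht := (posRoot_spec hcrys ht).2.1
  act_reflection ht v := by rw [(posRoot_spec hcrys ht).2.2, formReflection_apply]
  height_pos {t} ht := by
    obtain ⟨h0, h2, -⟩ := posRoot_spec hcrys ht
    rw [Finsupp.linearCombination_apply, Finsupp.sum]
    simp only [smul_eq_mul, mul_one]
    refine Finset.sum_pos (fun i hi => lt_of_le_of_ne (h0 i) (Finsupp.mem_support_iff.mp hi).symm)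
      (Finsupp.support_nonempty_iff.mpr fun h => ?_)
    simp [h] at h2
  eq_of_root_eq_smul ht hr _ := eq_of_posRoot_eq_smul hcrys ht hr
  act_root_of_lt ht := geomRep_posRoot_of_lt hcrys ht
  act_root_of_gt ht := geomRep_posRoot_of_gt hcrys ht

end

/-- If a Bruhat interval `[u,w]` in a Weyl group is a zircon, then the degree
of `w` in the Bruhat graph of `[u,w]` equals `ℓ(w) - ℓ(u)`. -/
theorem zircon_top_degree {B W : Type*} [Group W] [Finite W] {M : CoxeterMatrix B}
    (cs : CoxeterSystem M W)
    (hcrys : ∀ i j : B, i ≠ j → M i j ∈ ({2, 3, 4, 6} : Set ℕ))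
    (u w : W) (huw : BruhatLE cs u w) (hne : u ≠ w)
    (hz : IsZircon (BruhatInterval cs u w)) :
    bruhatDeg cs u w w = cs.length w - cs.length u :=
  (geomRootData cs hcrys).bruhatDeg_self_eq hz huw .refl

end Paper
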